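/- arXiv:2312.06124 — 3 statements merged into one kernel-verified Lean document; each statement's English description precedes it below -/
import Mathlib

section
/- Let R be a Cohen-Macaulay local ring of dimension d and M a maximal Cohen-Macaulay finitely generated R-module. If Hom_R(M,R) has finite Gorenstein dimension, then M is reflexive, i.e., the natural map M → Hom_R(Hom_R(M,R),R) is an isomorphism. -/
open CategoryTheory Opposite

universe u

noncomputable section

/-- The Ext module `Ext^i_R(M,N)`. -/
def ExtMod (R : Type u) [CommRing R] (M N : ModuleCat.{u} R) (i : ℕ) : ModuleCat.{u} R :=
  ((Ext R (ModuleCat.{u} R) i).obj (op M)).obj N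

/-- The Tor module `Tor_i^R(M,N)`. -/
def TorMod (R : Type u) [CommRing R] (M N : ModuleCat.{u} R) (i : ℕ) : ModuleCat.{u} R :=
  ((Tor (ModuleCat.{u} R) i).obj M).obj N

/-- The depth of a module over a local ring, as the least `i` with
`Ext^i(k, M) ≠ 0`. -/
def moduleDepth (R : Type u) [CommRing R] [IsLocalRing R] (M : ModuleCat.{u} R) : ℕ∞ :=
  sInf {i : ℕ∞ | ∃ n : ℕ, i = n ∧
    Nontrivial (ExtMod R (ModuleCat.of R (IsLocalRing.ResidueField R)) M n)}

/-- A Cohen-Macaulay local ring of dimension `d`. -/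
def IsCMLocalOfDim (R : Type u) [CommRing R] [IsLocalRing R] [IsNoetherianRing R] (d : ℕ) : Prop :=
  ringKrullDim R = d ∧ moduleDepth R (ModuleCat.of R R) = d

/-- Totally reflexive modules. -/
def TotallyReflexive (R : Type u) [CommRing R] (M : Type u) [AddCommGroup M] [Module R M] : Prop :=
  Function.Bijective (Module.Dual.eval R M) ∧
  ∀ i : ℕ, 1 ≤ i →
    Subsingleton (ExtMod R (ModuleCat.of R M) (ModuleCat.of R R) i) ∧
    Subsingleton (ExtMod R (ModuleCat.of R (Module.Dual R M)) (ModuleCat.of R R) i)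

/-- `GdimLE R n M` : the Gorenstein dimension of `M` is at most `n`. -/
def GdimLE (R : Type u) [CommRing R] : ℕ → ModuleCat.{u} R → Prop
  | 0, M => TotallyReflexive R M
  | (n+1), M => ∃ (G : ModuleCat.{u} R) (g : G →ₗ[R] M), Module.Finite R G ∧
      TotallyReflexive R G ∧ Function.Surjective g ∧
      GdimLE R n (ModuleCat.of R (LinearMap.ker g))

/-- Finite Gorenstein dimension. -/
def FiniteGdim (R : Type u) [CommRing R] (M : Type u) [AddCommGroup M] [Module R M] : Prop :=
  ∃ n, GdimLE R n (ModuleCat.of R M)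

/-- `PdLE R n M` : the projective dimension of `M` is at most `n`. -/
def PdLE (R : Type u) [CommRing R] : ℕ → ModuleCat.{u} R → Prop
  | 0, M => Module.Projective R M
  | (n+1), M => ∃ (G : ModuleCat.{u} R) (g : G →ₗ[R] M), Module.Projective R G ∧
      Function.Surjective g ∧ PdLE R n (ModuleCat.of R (LinearMap.ker g))

/-- Finite projective dimension. -/
def FinitePd (R : Type u) [CommRing R] (M : Type u) [AddCommGroup M] [Module R M] : Prop :=
  ∃ n, PdLE R n (ModuleCat.of R M)

/-- A semidualizing module. -/
def Semidualizing (R : Type u) [CommRing R] (C : Type u) [AddCommGroup C] [Module R C] : Prop :=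
  Module.Finite R C ∧
  Function.Bijective (LinearMap.toSpanSingleton R (C →ₗ[R] C) LinearMap.id) ∧
  ∀ i : ℕ, 1 ≤ i → Subsingleton (ExtMod R (ModuleCat.of R C) (ModuleCat.of R C) i)

/-- Membership in the Auslander class with respect to `C`. -/
def InAuslanderClass (R : Type u) [CommRing R] (C : Type u) [AddCommGroup C] [Module R C]
    (X : Type u) [AddCommGroup X] [Module R X] : Prop :=
  Function.Bijective ((TensorProduct.mk R C X).flip) ∧
  (∀ i : ℕ, 1 ≤ i → Subsingleton (TorMod R (ModuleCat.of R C) (ModuleCat.of R X) i)) ∧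
  (∀ i : ℕ, 1 ≤ i →
    Subsingleton (ExtMod R (ModuleCat.of R C) (ModuleCat.of R (TensorProduct R C X)) i))

/-- Height of a prime ideal. -/
def primeHt (R : Type u) [CommRing R] (p : Ideal R) (hp : p.IsPrime) : ℕ∞ :=
  Order.height (⟨p, hp⟩ : PrimeSpectrum R)

/-- Finite injective dimension, via vanishing of `Ext` in high degrees. -/
def FiniteInjDim (R : Type u) [CommRing R] (M : Type u) [AddCommGroup M] [Module R M] : Prop :=
  ∃ n : ℕ, ∀ (N : ModuleCat.{u} R) (i : ℕ), n < i →
    Subsingleton (ExtMod R N (ModuleCat.of R M) i)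

/-- A canonical (dualizing) module over a Cohen-Macaulay local ring:
a semidualizing module of finite injective dimension. -/
def IsCanonicalModule (R : Type u) [CommRing R] (w : Type u) [AddCommGroup w] [Module R w] : Prop :=
  Semidualizing R w ∧ FiniteInjDim R w

end


namespace S12
open CategoryTheory Opposite

theorem ext_bridge (R : Type u) [CommRing R] (X Y : ModuleCat.{u} R) (n : ℕ)
    (h : Subsingleton (ExtMod R X Y n)) : Subsingleton (Abelian.Ext X Y n) := by
  let P := projectiveResolution X
  have h1 : Limits.IsZero ((P.complex.linearYonedaObj R Y).homology n) := by
    refine Limits.IsZero.of_iso ?_ (P.isoExt (R := R) n Y).symm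
    exact @ModuleCat.isZero_of_subsingleton R _ _ h
  rw [← HomologicalComplex.exactAt_iff_isZero_homology] at h1
  refine subsingleton_of_forall_eq 0 fun α => ?_
  obtain ⟨f, hf, rfl⟩ := P.extMk_surjective α (n+1) rfl
  cases n with
  | zero =>
    rw [HomologicalComplex.exactAt_iff' _ 0 0 1 (by simp) (by simp),
      ShortComplex.moduleCat_exact_iff] at h1
    obtain ⟨g, hg⟩ := h1 f hf
    have : f = 0 := by
      rw [← hg]
      have : (P.complex.linearYonedaObj R Y).d 0 0 = 0 := by
        apply HomologicalComplex.shape; simp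
      change (P.complex.linearYonedaObj R Y).d 0 0 g = 0
      rw [this]; rfl
    subst this
    simp
  | succ n =>
    rw [HomologicalComplex.exactAt_iff' _ n (n+1) (n+2) (by simp) (by simp),
      ShortComplex.moduleCat_exact_iff] at h1
    obtain ⟨g, hg⟩ := h1 f hf
    rw [P.extMk_eq_zero_iff f _ rfl hf n rfl]
    exact ⟨g, hg⟩

section wrappers
variable (R : Type u) [CommRing R]

/-- `Ext` between unbundled modules. -/
abbrev E (X Y : Type u) [AddCommGroup X] [Module R X] [AddCommGroup Y] [Module R Y] (n : ℕ) :=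
  Abelian.Ext (ModuleCat.of R X) (ModuleCat.of R Y) n

variable {R}
variable {A B C Y : Type u} [AddCommGroup A] [Module R A] [AddCommGroup B] [Module R B]
  [AddCommGroup C] [Module R C] [AddCommGroup Y] [Module R Y]

theorem ses {f : A →ₗ[R] B} {g : B →ₗ[R] C} (hf : Function.Injective f)
    (h : Function.Exact f g) (hg : Function.Surjective g) :
    (ModuleCat.shortComplexOfCompEqZero f g h.linearMap_comp_eq_zero).ShortExact where
  exact := (ShortComplex.ShortExact.moduleCat_exact_iff_function_exact _).mpr h
  mono_f := (ModuleCat.mono_iff_injective _).mpr hf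
  epi_g := (ModuleCat.epi_iff_surjective _).mpr hg

theorem c2 {f : A →ₗ[R] B} {g : B →ₗ[R] C} (hf : Function.Injective f)
    (h : Function.Exact f g) (hg : Function.Surjective g) (n : ℕ)
    (hA : Subsingleton (E R A Y n)) (hC : Subsingleton (E R C Y n)) :
    Subsingleton (E R B Y n) := by
  refine subsingleton_of_forall_eq 0 fun x => ?_
  obtain ⟨y, hy⟩ := Abelian.Ext.contravariant_sequence_exact₂ (ses hf h hg) _ x
    (Subsingleton.elim (α := E R A Y n) _ _)
  rw [← hy, Subsingleton.elim (α := E R C Y n) y 0]; simp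

theorem c1 {f : A →ₗ[R] B} {g : B →ₗ[R] C} (hf : Function.Injective f)
    (h : Function.Exact f g) (hg : Function.Surjective g) (n : ℕ) (s : R)
    (hB : ∀ e : E R B Y n, s • e = 0) (hC : Subsingleton (E R C Y (n+1))) (e : E R A Y n) :
    s • e = 0 := by
  obtain ⟨y, hy⟩ := Abelian.Ext.contravariant_sequence_exact₁ (ses hf h hg) _ e (add_comm 1 n)
    (Subsingleton.elim (α := E R C Y (n+1)) _ _)
  rw [← hy, ← Abelian.Ext.comp_smul, hB]; simp

theorem c1' {f : A →ₗ[R] B} {g : B →ₗ[R] C} (hf : Function.Injective f)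
    (h : Function.Exact f g) (hg : Function.Surjective g) (n : ℕ)
    (hB : Subsingleton (E R B Y n)) (hC : Subsingleton (E R C Y (n+1))) :
    Subsingleton (E R A Y n) := by
  refine subsingleton_of_forall_eq 0 fun x => ?_
  simpa using c1 hf h hg n 1 (fun e => Subsingleton.elim _ _) hC x

theorem c3 {f : A →ₗ[R] B} {g : B →ₗ[R] C} (hf : Function.Injective f)
    (h : Function.Exact f g) (hg : Function.Surjective g) (n : ℕ)
    (hA : Subsingleton (E R A Y n)) (hB : Subsingleton (E R B Y (n+1))) :
    Subsingleton (E R C Y (n+1)) := by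
  refine subsingleton_of_forall_eq 0 fun x => ?_
  obtain ⟨y, hy⟩ := Abelian.Ext.contravariant_sequence_exact₃ (ses hf h hg) _ x
    (Subsingleton.elim (α := E R B Y (n+1)) _ _) (add_comm 1 n)
  rw [← hy, Subsingleton.elim (α := E R A Y n) y 0]; simp

/-- extension of maps -/
theorem ext_of_kill {f : A →ₗ[R] B} {g : B →ₗ[R] C} (hf : Function.Injective f)
    (h : Function.Exact f g) (hg : Function.Surjective g) (s : R)
    (hC : ∀ e : E R C Y 1, s • e = 0) (φ : A →ₗ[R] Y) :
    ∃ ψ : B →ₗ[R] Y, ∀ a, ψ (f a) = s • φ a := by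
  obtain ⟨y, hy⟩ := Abelian.Ext.contravariant_sequence_exact₁ (ses hf h hg) _
    (Abelian.Ext.mk₀ (ModuleCat.ofHom (s • φ))) (add_comm 1 0) (by
      have : ModuleCat.ofHom (s • φ) = s • ModuleCat.ofHom φ := rfl
      rw [this, Abelian.Ext.mk₀_smul, Abelian.Ext.comp_smul]
      exact hC _)
  obtain ⟨ψ, rfl⟩ := Abelian.Ext.homEquiv₀.symm.surjective y
  refine ⟨ψ.hom, fun a => ?_⟩
  have h2 : Abelian.Ext.mk₀ (ModuleCat.ofHom f ≫ ψ) = Abelian.Ext.mk₀ (ModuleCat.ofHom (s • φ)) := by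
    rw [← hy]; simp
  have h3 := Abelian.Ext.homEquiv₀.symm.injective h2
  exact congrArg (fun q => q.hom a) h3

theorem ext_of_zero {f : A →ₗ[R] B} {g : B →ₗ[R] C} (hf : Function.Injective f)
    (h : Function.Exact f g) (hg : Function.Surjective g)
    (hC : Subsingleton (E R C Y 1)) (φ : A →ₗ[R] Y) :
    ∃ ψ : B →ₗ[R] Y, ∀ a, ψ (f a) = φ a := by
  simpa using ext_of_kill hf h hg 1 (fun e => Subsingleton.elim _ _) φ

theorem E_proj [Module.Projective R A] (n : ℕ) : Subsingleton (E R A Y (n+1)) := by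
  have : Projective (ModuleCat.of R A) := (IsProjective.iff_projective A).mp inferInstance
  exact subsingleton_of_forall_eq 0 fun x => Abelian.Ext.eq_zero_of_projective x

theorem kill_of_ext {f : A →ₗ[R] B} {g : B →ₗ[R] C} (hf : Function.Injective f)
    (h : Function.Exact f g) (hg : Function.Surjective g) [Module.Projective R B] (s : R)
    (H : ∀ φ : A →ₗ[R] Y, ∃ ψ : B →ₗ[R] Y, ∀ a, ψ (f a) = s • φ a) (e : E R C Y 1) :
    s • e = 0 := by
  obtain ⟨y, rfl⟩ := Abelian.Ext.contravariant_sequence_exact₃ (ses hf h hg) _ e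
    ((E_proj (A := B) 0).elim _ _) (add_comm 1 0)
  obtain ⟨φ, rfl⟩ := Abelian.Ext.homEquiv₀.symm.surjective y
  obtain ⟨ψ, hψ⟩ := H φ.hom
  rw [← Abelian.Ext.comp_smul]
  have : s • (Abelian.Ext.mk₀ φ) = (Abelian.Ext.mk₀ (ModuleCat.ofHom f)).comp
      (Abelian.Ext.mk₀ (ModuleCat.ofHom ψ)) (zero_add 0) := by
    rw [Abelian.Ext.mk₀_comp_mk₀, ← Abelian.Ext.mk₀_smul]
    congr 1
    ext a
    exact (hψ a).symm
  change (ses hf h hg).extClass.comp (s • Abelian.Ext.mk₀ φ) _ = 0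
  rw [this]
  exact (ses hf h hg).extClass_comp_assoc _

theorem ext0 (h : ∀ φ : A →ₗ[R] Y, φ = 0) : Subsingleton (E R A Y 0) := by
  refine subsingleton_of_forall_eq 0 fun x => ?_
  obtain ⟨φ, rfl⟩ := Abelian.Ext.homEquiv₀.symm.surjective x
  have : φ = 0 := by ext a; exact congrArg (fun q => q a) (h φ.hom)
  subst this; simp

theorem ext0' (h : Subsingleton (E R A Y 0)) (φ : A →ₗ[R] Y) : φ = 0 := by
  have := Abelian.Ext.homEquiv₀.symm.injective (h.elim (Abelian.Ext.mk₀ (ModuleCat.ofHom φ)) (Abelian.Ext.mk₀ (ModuleCat.ofHom 0)))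
  exact congrArg (fun q => q.hom) this

/-- invariance under isomorphism -/
theorem E_iso (e : A ≃ₗ[R] B) (n : ℕ) (h : Subsingleton (E R A Y n)) :
    Subsingleton (E R B Y n) := by
  refine subsingleton_of_forall_eq 0 fun x => ?_
  have h1 : (Abelian.Ext.mk₀ (ModuleCat.ofHom e.symm.toLinearMap)).comp
      ((Abelian.Ext.mk₀ (ModuleCat.ofHom e.toLinearMap)).comp x (zero_add n)) (zero_add n) = x := by
    rw [Abelian.Ext.mk₀_comp_mk₀_assoc]
    have : ModuleCat.ofHom e.symm.toLinearMap ≫ ModuleCat.ofHom e.toLinearMap = 𝟙 _ := by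
      ext a; simp
    rw [this]; simp
  rw [← h1, h.elim ((Abelian.Ext.mk₀ (ModuleCat.ofHom e.toLinearMap)).comp x (zero_add n)) 0]
  simp

/-- multiplication by `x` on the first argument -/
theorem mul_surj {g : A →ₗ[R] C} (x : R) (hx : Function.Injective (x • (LinearMap.id : A →ₗ[R] A)))
    (h : Function.Exact (x • (LinearMap.id : A →ₗ[R] A)) g) (hg : Function.Surjective g) (n : ℕ)
    (hC : Subsingleton (E R C Y (n+1))) (e : E R A Y n) : ∃ e' : E R A Y n, x • e' = e := by
  obtain ⟨y, hy⟩ := Abelian.Ext.contravariant_sequence_exact₁ (ses hx h hg) _ e (add_comm 1 n)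
    (Subsingleton.elim (α := E R C Y (n+1)) _ _)
  refine ⟨y, ?_⟩
  rw [← hy]
  have : ModuleCat.ofHom (x • (LinearMap.id : A →ₗ[R] A)) = x • 𝟙 (ModuleCat.of R A) := rfl
  change _ = (Abelian.Ext.mk₀ (ModuleCat.ofHom (x • (LinearMap.id : A →ₗ[R] A)))).comp y _
  rw [this, Abelian.Ext.mk₀_smul, Abelian.Ext.smul_comp]; simp

end wrappers


section ischebeck

theorem dim_lt {R : Type u} [CommRing R] (p q : Ideal R) [hp : p.IsPrime] (x : R)
    (hpq : p ≤ q) (hxp : x ∉ p) (hxq : x ∈ q) :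
    ringKrullDim (R ⧸ q) + 1 ≤ ringKrullDim (R ⧸ p) := by
  have hx : (Ideal.Quotient.mk p x) ∈ nonZeroDivisors (R ⧸ p) := by
    rw [mem_nonZeroDivisors_iff_ne_zero]
    rwa [Ne, Ideal.Quotient.eq_zero_iff_mem]
  refine le_trans ?_ (ringKrullDim_quotient_succ_le_of_nonZeroDivisor hx)
  gcongr
  let φ : (R ⧸ p) →+* (R ⧸ q) := Ideal.Quotient.factor hpq
  let ψ : ((R ⧸ p) ⧸ Ideal.span {Ideal.Quotient.mk p x}) →+* (R ⧸ q) :=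
    Ideal.Quotient.lift _ φ (by
      intro a ha
      have : Ideal.span {Ideal.Quotient.mk p x} ≤ RingHom.ker φ := by
        rw [Ideal.span_singleton_le_iff_mem, RingHom.mem_ker]
        simpa [φ, Ideal.Quotient.eq_zero_iff_mem] using hxq
      exact this ha)
  refine ringKrullDim_le_of_surjective ψ ?_
  intro y
  obtain ⟨y, rfl⟩ := Ideal.Quotient.mk_surjective y
  exact ⟨Ideal.Quotient.mk _ (Ideal.Quotient.mk _ y), rfl⟩

variable {R : Type u} [CommRing R] [IsLocalRing R] [IsNoetherianRing R]

theorem withbot_cancel {a : WithBot ℕ∞} {r : ℕ} (h : a + 1 ≤ ((r + 1 : ℕ) : WithBot ℕ∞)) : a ≤ r := by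
  induction a with
  | bot => exact bot_le
  | coe a =>
    have h : ((a + 1 : ℕ∞) : WithBot ℕ∞) ≤ (((r + 1 : ℕ) : ℕ∞) : WithBot ℕ∞) := by simpa using h
    rw [WithBot.coe_le_coe] at h
    have h2 : a ≤ (r : ℕ∞) := by
      push_cast at h
      exact (ENat.add_le_add_iff_right (by simp)).mp h
    exact_mod_cast WithBot.coe_le_coe.mpr h2

theorem isch_aux {M : Type u} [AddCommGroup M] [Module R M] [Module.Finite R M] (p : Ideal R)
    [p.IsPrime] (x : R) (hxm : x ∈ IsLocalRing.maximalIdeal R) (hx : x ∉ p) (i : ℕ)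
    (H : ∀ (C : Type u) [AddCommGroup C] [Module R C] [Module.Finite R C],
      (∀ q ∈ Module.support R C, p ≤ q.asIdeal ∧ x ∈ q.asIdeal) → Subsingleton (E R C M (i+1))) :
    Subsingleton (E R (R ⧸ p) M i) := by
  let m : (R ⧸ p) →ₗ[R] (R ⧸ p) := x • LinearMap.id
  have hm : Function.Injective m := by
    rw [← LinearMap.ker_eq_bot, LinearMap.ker_eq_bot']
    intro a ha
    obtain ⟨a, rfl⟩ := Ideal.Quotient.mk_surjective a
    have ha' : Ideal.Quotient.mk p (x * a) = 0 := by rw [← ha]; simp [m, Algebra.smul_def]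
    rw [Ideal.Quotient.eq_zero_iff_mem] at ha' ⊢
    exact (Ideal.IsPrime.mem_or_mem ‹_› ha').resolve_left hx
  have hC := H ((R ⧸ p) ⧸ LinearMap.range m) (by
    intro q hq
    rw [Module.mem_support_iff_of_finite] at hq
    constructor
    · refine le_trans (fun a ha => ?_) hq
      rw [Module.mem_annihilator]
      intro z
      obtain ⟨z, rfl⟩ := Submodule.mkQ_surjective _ z
      obtain ⟨z, rfl⟩ := Ideal.Quotient.mk_surjective z
      have : a • (Ideal.Quotient.mk p z) = 0 := by
        have : a • (Ideal.Quotient.mk p z) = Ideal.Quotient.mk p (a * z) := by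
          simp [Algebra.smul_def]
        rw [this, Ideal.Quotient.eq_zero_iff_mem]
        exact Ideal.mul_mem_right _ _ ha
      rw [← map_smul, this, map_zero]
    · apply hq
      rw [Module.mem_annihilator]
      intro z
      obtain ⟨z, rfl⟩ := Submodule.mkQ_surjective _ z
      rw [← map_smul, Submodule.mkQ_apply, Submodule.Quotient.mk_eq_zero]
      exact ⟨z, rfl⟩)
  have hs := mul_surj (Y := M) x hm (g := (LinearMap.range m).mkQ)
    (LinearMap.exact_map_mkQ_range m) (Submodule.mkQ_surjective _) i hC
  have htop : (⊤ : Submodule R (E R (R ⧸ p) M i)) = ⊥ := by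
    refine Submodule.eq_bot_of_le_smul_of_le_jacobson_bot (IsLocalRing.maximalIdeal R) ⊤
      Module.Finite.fg_top ?_ (IsLocalRing.maximalIdeal_le_jacobson _)
    intro e _
    obtain ⟨e', rfl⟩ := hs e
    exact Submodule.smul_mem_smul hxm trivial
  exact (Submodule.subsingleton_iff R).mp (subsingleton_of_bot_eq_top htop.symm)

theorem isch {M : Type u} [AddCommGroup M] [Module R M] [Module.Finite R M] (d : ℕ)
    (hd : ∀ i < d, Subsingleton (E R (IsLocalRing.ResidueField R) M i)) (r : ℕ) :
    ∀ (X : Type u) [AddCommGroup X] [Module R X] [Module.Finite R X],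
      (∀ q ∈ Module.support R X, ringKrullDim (R ⧸ q.asIdeal) ≤ r) → ∀ i, i + r < d →
      Subsingleton (E R X M i) := by
  induction r using Nat.strong_induction_on with
  | _ r ih =>
  intro X _ _ hfin
  induction hfin using IsNoetherianRing.induction_on_isQuotientEquivQuotientPrime R with
  | subsingleton N =>
    intro _ i _
    refine subsingleton_of_forall_eq 0 fun e => ?_
    have : 𝟙 (ModuleCat.of R N) = 0 := by ext a; exact Subsingleton.elim (α := N) _ _
    rw [← Abelian.Ext.mk₀_id_comp e, this]; simp
  | exact N₁ N₂ N₃ f g hf hg h h1 h3 =>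
    intro hX i hi
    rw [Module.support_of_exact h hf hg] at hX
    exact c2 hf h hg i (h1 (fun q hq => hX q (Or.inl hq)) i hi)
      (h3 (fun q hq => hX q (Or.inr hq)) i hi)
  | quotient N p e =>
    intro hX i hi
    refine E_iso e.symm i ?_
    have hp : ringKrullDim (R ⧸ p.asIdeal) ≤ r := by
      apply hX
      rw [e.support_eq, Module.mem_support_iff_of_finite, Ideal.annihilator_quotient]
    by_cases hpm : p.asIdeal = IsLocalRing.maximalIdeal R
    · rw [hpm]
      exact hd i (by omega)
    · have hle := IsLocalRing.le_maximalIdeal p.2.ne_top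
      obtain ⟨x, hxm, hx⟩ := SetLike.exists_of_lt (lt_of_le_of_ne hle hpm)
      cases r with
      | zero =>
        exfalso
        have h1 := (dim_lt p.asIdeal _ x hle hx hxm).trans hp
        have h0 : (0 : WithBot ℕ∞) ≤ ringKrullDim (R ⧸ IsLocalRing.maximalIdeal R) :=
          ringKrullDim_nonneg_of_nontrivial
        have h2 : (0 : WithBot ℕ∞) + 1 ≤ 0 := (add_le_add_left h0 1).trans h1
        exact absurd h2 (by simp)
      | succ r =>
        refine isch_aux p.asIdeal x hxm hx i ?_
        intro C _ _ _ hC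
        refine ih r (by omega) C (fun q hq => ?_) (i+1) (by omega)
        exact withbot_cancel ((dim_lt p.asIdeal q.asIdeal x (hC q hq).1 hx (hC q hq).2).trans hp)

end ischebeck


section dims

theorem dim_reg {A B : Type u} [CommRing A] [CommRing B] (f : A →+* B) (hf : Function.Surjective f)
    (a : A) (ha : IsSMulRegular A a) (h0 : f a = 0) : ringKrullDim B + 1 ≤ ringKrullDim A := by
  have ha' : a ∈ nonZeroDivisors A := by
    rw [mem_nonZeroDivisors_iff_right]
    intro z hz
    have : a • z = a • 0 := by simpa [mul_comm] using hz
    exact ha this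
  refine le_trans ?_ (ringKrullDim_quotient_succ_le_of_nonZeroDivisor ha')
  gcongr
  let ψ : (A ⧸ Ideal.span {a}) →+* B :=
    Ideal.Quotient.lift _ f (by
      intro z hz
      have : Ideal.span {a} ≤ RingHom.ker f := by
        rw [Ideal.span_singleton_le_iff_mem, RingHom.mem_ker, h0]
      exact this hz)
  refine ringKrullDim_le_of_surjective ψ ?_
  intro y
  obtain ⟨y, rfl⟩ := hf y
  exact ⟨Ideal.Quotient.mk _ y, rfl⟩

variable {R : Type u} [CommRing R] [IsLocalRing R] [IsNoetherianRing R]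

theorem mem_supp {C : Type u} [AddCommGroup C] [Module R C] [Module.Finite R C] (x : R)
    (hx : ∀ c : C, x • c = 0) (q : PrimeSpectrum R) (hq : q ∈ Module.support R C) :
    x ∈ q.asIdeal := by
  rw [Module.mem_support_iff_of_finite] at hq
  exact hq (Module.mem_annihilator.mpr hx)

theorem nonneg_q (q : PrimeSpectrum R) : (0 : WithBot ℕ∞) ≤ ringKrullDim (R ⧸ q.asIdeal) :=
  ringKrullDim_nonneg_of_nontrivial

theorem reg1 {M : Type u} [AddCommGroup M] [Module R M] [Module.Finite R M] (d : ℕ)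
    (hdim : ringKrullDim R = d)
    (hd : ∀ i < d, Subsingleton (E R (IsLocalRing.ResidueField R) M i)) (x : R)
    (hx : IsSMulRegular R x) (m : M) (hm : x • m = 0) : m = 0 := by
  let X := Submodule.span R {m}
  have hann : ∀ c : X, x • c = 0 := by
    rintro ⟨c, hc⟩
    obtain ⟨a, rfl⟩ := Submodule.mem_span_singleton.mp hc
    ext; simp [smul_comm x a, hm]
  have hsupp : ∀ q ∈ Module.support R X, ringKrullDim (R ⧸ q.asIdeal) + 1 ≤ (d : WithBot ℕ∞) := by
    intro q hq
    rw [← hdim]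
    exact dim_reg (Ideal.Quotient.mk q.asIdeal) Ideal.Quotient.mk_surjective x hx
      (Ideal.Quotient.eq_zero_iff_mem.mpr (mem_supp x hann q hq))
  rcases Nat.eq_zero_or_pos d with rfl | hpos
  · have : Module.support R X = ∅ := by
      rw [Set.eq_empty_iff_forall_notMem]
      intro q hq
      have h2 : (0 : WithBot ℕ∞) + 1 ≤ 0 := (add_le_add_left (nonneg_q q) 1).trans (hsupp q hq)
      exact absurd h2 (by simp)
    rw [Module.support_eq_empty_iff] at this
    exact congrArg Subtype.val (this.elim ⟨m, Submodule.mem_span_singleton_self m⟩ 0)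
  · obtain ⟨r, rfl⟩ := Nat.exists_eq_add_of_lt hpos
    have := isch (M := M) _ hd r X (fun q hq => withbot_cancel (by simpa using hsupp q hq)) 0
      (by omega)
    have h0 := ext0' this X.subtype
    exact congrArg (fun q => q ⟨m, Submodule.mem_span_singleton_self m⟩) h0

theorem reg2 {M C : Type u} [AddCommGroup M] [Module R M] [Module.Finite R M] (d : ℕ)
    [AddCommGroup C] [Module R C] [Module.Finite R C]
    (hdim : ringKrullDim R = d)
    (hd : ∀ i < d, Subsingleton (E R (IsLocalRing.ResidueField R) M i)) (x y : R)
    (hx : IsSMulRegular R x) (hy : IsSMulRegular (R ⧸ Ideal.span {x}) (Ideal.Quotient.mk (Ideal.span {x}) y))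
    (hxC : ∀ c : C, x • c = 0) (hyC : ∀ c : C, y • c = 0) : Subsingleton (E R C M 1) := by
  have hsupp : ∀ q ∈ Module.support R C, ringKrullDim (R ⧸ q.asIdeal) + 1 + 1 ≤ (d : WithBot ℕ∞) := by
    intro q hq
    rw [← hdim]
    have h1 := dim_reg (Ideal.Quotient.mk (Ideal.span {x})) Ideal.Quotient.mk_surjective x hx
      (Ideal.Quotient.eq_zero_iff_mem.mpr (Ideal.mem_span_singleton_self x))
    refine le_trans ?_ h1
    gcongr
    have hle : Ideal.span {x} ≤ q.asIdeal := by
      rw [Ideal.span_singleton_le_iff_mem]; exact mem_supp x hxC q hq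
    refine dim_reg (Ideal.Quotient.factor hle) (Ideal.Quotient.factor_surjective hle) _ hy ?_
    simpa [Ideal.Quotient.eq_zero_iff_mem] using mem_supp y hyC q hq
  by_cases hpos : d < 2
  · have : Module.support R C = ∅ := by
      rw [Set.eq_empty_iff_forall_notMem]
      intro q hq
      have h2 : (0 : WithBot ℕ∞) + 1 + 1 ≤ d :=
        (add_le_add_left (add_le_add_left (nonneg_q q) 1) 1).trans (hsupp q hq)
      have h3 : ((2 : ℕ) : WithBot ℕ∞) ≤ d := by
        refine le_trans (le_of_eq ?_) h2
        norm_num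
      have : 2 ≤ d := by exact_mod_cast h3
      omega
    rw [Module.support_eq_empty_iff] at this
    exact E_proj 0
  · obtain ⟨r, rfl⟩ := Nat.exists_eq_add_of_le (not_lt.mp hpos)
    refine isch (M := M) _ hd r C (fun q hq => withbot_cancel (withbot_cancel ?_)) 1 (by omega)
    have := hsupp q hq
    rwa [show 2 + r = r + 1 + 1 by omega] at this

end dims


section fpd

/-- finite free resolutions of length at most `n` -/
def FPD (R : Type u) [CommRing R] : ℕ → (X : Type u) → [AddCommGroup X] → [Module R X] → Prop
  | 0, X, _, _ => Subsingleton X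
  | n + 1, X, _, _ => ∃ (k : ℕ) (K : Type u) (_ : AddCommGroup K) (_ : Module R K)
      (f : K →ₗ[R] (Fin k → R)) (g : (Fin k → R) →ₗ[R] X),
      Function.Injective f ∧ Function.Exact f g ∧ Function.Surjective g ∧ FPD R n K

theorem descend {R : Type u} [CommRing R] {A B C : Type u} [AddCommGroup A] [Module R A]
    [AddCommGroup B] [Module R B] [AddCommGroup C] [Module R C] (g : A →ₗ[R] B)
    (hg : Function.Surjective g) (h : A →ₗ[R] C) (H : ∀ a, g a = 0 → h a = 0) :
    ∃ c : B →ₗ[R] C, ∀ a, c (g a) = h a := by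
  refine ⟨((LinearMap.ker g).liftQ h (fun a ha => H a ha)).comp
    (g.quotKerEquivOfSurjective hg).symm.toLinearMap, fun a => ?_⟩
  have : (g.quotKerEquivOfSurjective hg).symm (g a) = (LinearMap.ker g).mkQ a := by
    rw [LinearEquiv.symm_apply_eq]; rfl
  simp only [LinearMap.comp_apply, LinearEquiv.coe_coe, this]
  rfl

theorem pi_sum {R : Type u} [CommRing R] {k : ℕ} {B : Type u} [AddCommGroup B] [Module R B]
    (h : (Fin k → R) →ₗ[R] B) (v : Fin k → R) : h v = ∑ i, v i • h (Pi.single i 1) := by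
  conv_lhs => rw [pi_eq_sum_univ' v]
  rw [map_sum]
  simp [Pi.single]

theorem e1_aux {R : Type u} [CommRing R] {K : Type u} [AddCommGroup K] [Module R K] {k k0 : ℕ}
    (f : K →ₗ[R] (Fin k → R)) (hf : Function.Injective f) (s : R) (hs : IsSMulRegular R s)
    (a : K →ₗ[R] (Fin k0 → R)) (b : (Fin k0 → R) →ₗ[R] K) (hab : ∀ z, b (a z) = s • z)
    (φ : ((K →ₗ[R] R) ⧸ LinearMap.range (LinearMap.lcomp R R f)) →ₗ[R] R) : φ = 0 := by
  let N := LinearMap.range (LinearMap.lcomp R R f)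
  let f0 : Fin k0 → R := fun i => φ (N.mkQ (LinearMap.proj i ∘ₗ a))
  have key : ∀ g : K →ₗ[R] R, s * φ (N.mkQ g) = g (b f0) := by
    intro g
    have h1 : s • g = ∑ i, (g (b (Pi.single i 1))) • (LinearMap.proj i ∘ₗ a) := by
      ext z
      have := pi_sum (g ∘ₗ b) (a z)
      simp only [LinearMap.comp_apply, hab, map_smul] at this
      rw [LinearMap.smul_apply, LinearMap.sum_apply, this]
      refine Finset.sum_congr rfl fun i _ => ?_
      simp [mul_comm]
    have h2 := pi_sum (g ∘ₗ b) f0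
    rw [LinearMap.comp_apply] at h2
    rw [h2, ← smul_eq_mul, ← map_smul, ← map_smul, h1, map_sum, map_sum]
    refine Finset.sum_congr rfl fun i _ => ?_
    simp only [map_smul, smul_eq_mul, LinearMap.comp_apply, f0]
    ring
  have hz : b f0 = 0 := by
    apply hf
    rw [map_zero]
    ext i
    have h1 := key (LinearMap.proj i ∘ₗ f)
    have h2 : N.mkQ (LinearMap.proj i ∘ₗ f) = 0 := by
      rw [Submodule.mkQ_apply, Submodule.Quotient.mk_eq_zero]
      exact ⟨LinearMap.proj i, rfl⟩
    rw [h2] at h1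
    simpa using h1.symm
  ext g
  apply hs
  have := key g
  rw [hz] at this
  simpa using this

theorem e1 {R : Type u} [CommRing R] [IsNoetherianRing R] (n : ℕ) :
    ∀ (X : Type u) [AddCommGroup X] [Module R X], FPD R n X →
    ∃ s : R, IsSMulRegular R s ∧ ∃ (k : ℕ) (a : X →ₗ[R] (Fin k → R)) (b : (Fin k → R) →ₗ[R] X),
      ∀ z, b (a z) = s • z := by
  induction n with
  | zero =>
    intro X _ _ h
    have : Subsingleton X := h
    exact ⟨1, IsSMulRegular.one R, 0, 0, 0, fun z => Subsingleton.elim _ _⟩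
  | succ n ih =>
    intro X _ _ h
    obtain ⟨k, K, _, _, f, g, hf, hfg, hg, hK⟩ := h
    obtain ⟨s, hs, k0, a, b, hab⟩ := ih K hK
    have : Module.Finite R K := Module.Finite.of_injective f hf
    obtain ⟨t, ht, hreg⟩ := (IsSMulRegular.subsingleton_linearMap_iff (R := R) (M := R)
      (N := (K →ₗ[R] R) ⧸ LinearMap.range (LinearMap.lcomp R R f))).mp
      (subsingleton_of_forall_eq 0 (e1_aux f hf s hs a b hab))
    have hex : ∀ i, ∃ ψ : (Fin k → R) →ₗ[R] R, ∀ z, ψ (f z) = t * a z i := by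
      intro i
      have h1 := Module.mem_annihilator.mp ht
        ((LinearMap.range (LinearMap.lcomp R R f)).mkQ (LinearMap.proj i ∘ₗ a))
      rw [← map_smul, Submodule.mkQ_apply, Submodule.Quotient.mk_eq_zero] at h1
      obtain ⟨ψ, hψ⟩ := h1
      exact ⟨ψ, fun z => congrArg (fun q => q z) hψ⟩
    choose ψ hψ using hex
    let a' : (Fin k → R) →ₗ[R] (Fin k0 → R) := LinearMap.pi ψ
    have ha' : ∀ z, a' (f z) = t • a z := by
      intro z; ext i; simp [a', hψ]
    obtain ⟨c, hc⟩ := descend g hg ((t * s) • LinearMap.id - f ∘ₗ b ∘ₗ a') (by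
      intro w hw
      obtain ⟨z, rfl⟩ := (hfg w).mp hw
      simp [ha', hab, mul_smul])
    refine ⟨t * s, hreg.mul hs, k, c, g, fun z => ?_⟩
    obtain ⟨w, rfl⟩ := hg z
    simp [hc, hfg.apply_apply_eq_zero]

end fpd


section fpdmod

theorem red_ker {R : Type u} [CommRing R] (x : R) {K : Type u} [AddCommGroup K] [Module R K]
    (z : K) : (Ideal.span {x} • (⊤ : Submodule R K)).mkQ z = 0 ↔ ∃ z', z = x • z' := by
  rw [Submodule.mkQ_apply, Submodule.Quotient.mk_eq_zero, Submodule.ideal_span_singleton_smul]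
  constructor
  · intro h
    obtain ⟨y, _, hy⟩ := (Submodule.mem_smul_pointwise_iff_exists _ _ _).mp h
    exact ⟨y, hy.symm⟩
  · rintro ⟨y, rfl⟩
    exact Submodule.smul_mem_pointwise_smul _ _ _ trivial

/-- coordinatewise reduction -/
def redPi {R : Type u} [CommRing R] (x : R) (k : ℕ) :
    (Fin k → R) →ₗ[R] (Fin k → R ⧸ Ideal.span {x}) :=
  LinearMap.pi fun i => (Ideal.span {x} : Ideal R).mkQ ∘ₗ LinearMap.proj i

theorem redPi_apply {R : Type u} [CommRing R] (x : R) (k : ℕ) (w : Fin k → R) (i : Fin k) :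
    redPi x k w i = Ideal.Quotient.mk (Ideal.span {x}) (w i) := rfl

theorem redPi_surj {R : Type u} [CommRing R] (x : R) (k : ℕ) :
    Function.Surjective (redPi x k) := by
  intro v
  choose w hw using fun i => Ideal.Quotient.mk_surjective (v i)
  exact ⟨w, funext fun i => hw i⟩

theorem redPi_ker {R : Type u} [CommRing R] (x : R) (k : ℕ) (w : Fin k → R) :
    redPi x k w = 0 ↔ ∃ w', w = x • w' := by
  constructor
  · intro h
    have : ∀ i, ∃ c, w i = x * c := by
      intro i
      have h1 := congrFun h i
      rw [redPi_apply, Pi.zero_apply, Ideal.Quotient.eq_zero_iff_mem,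
        Ideal.mem_span_singleton] at h1
      exact h1
    choose c hc using this
    exact ⟨c, funext fun i => by simp [hc]⟩
  · rintro ⟨w', rfl⟩
    ext i
    rw [redPi_apply, Pi.zero_apply, Ideal.Quotient.eq_zero_iff_mem, Ideal.mem_span_singleton]
    exact ⟨w' i, by simp⟩

theorem mk_surj' {R : Type u} [CommRing R] (x : R) :
    Function.Surjective (algebraMap R (R ⧸ Ideal.span {x})) := Ideal.Quotient.mk_surjective

theorem fpd_mod {R : Type u} [CommRing R] (x : R) (hx : IsSMulRegular R x) (n : ℕ) :
    ∀ (X : Type u) [AddCommGroup X] [Module R X] (Xb : Type u) [AddCommGroup Xb] [Module R Xb]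
      [Module (R ⧸ Ideal.span {x}) Xb] [IsScalarTower R (R ⧸ Ideal.span {x}) Xb]
      (p : X →ₗ[R] Xb), Function.Surjective p → (∀ z, p z = 0 ↔ ∃ z', z = x • z') →
      IsSMulRegular X x → FPD R n X → FPD (R ⧸ Ideal.span {x}) n Xb := by
  induction n with
  | zero =>
    intro X _ _ Xb _ _ _ _ p hp _ _ h
    have : Subsingleton X := h
    exact hp.subsingleton
  | succ n ih =>
    intro X _ _ Xb _ _ _ _ p hp hker hxX h
    obtain ⟨k, K, _, _, f, g, hf, hfg, hg, hK⟩ := h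
    let q := (Ideal.span {x} • (⊤ : Submodule R K)).mkQ
    have hq : Function.Surjective q := Submodule.mkQ_surjective _
    have hxK : IsSMulRegular K x := by
      intro a b hab
      apply hf
      have : x • f a = x • f b := by rw [← map_smul, ← map_smul]; exact congrArg f hab
      ext i
      exact hx (congrFun this i)
    obtain ⟨f0, hf0⟩ := descend q hq (redPi x k ∘ₗ f) (by
      intro a ha
      obtain ⟨z, rfl⟩ := (red_ker x a).mp ha
      rw [map_smul]
      rw [LinearMap.comp_apply, ← map_smul]
      exact (redPi_ker x k _).mpr ⟨_, rfl⟩)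
    obtain ⟨g0, hg0⟩ := descend (redPi x k) (redPi_surj x k) (p ∘ₗ g) (by
      intro a ha
      obtain ⟨z, rfl⟩ := (redPi_ker x k a).mp ha
      rw [LinearMap.comp_apply, map_smul]
      exact (hker _).mpr ⟨_, rfl⟩)
    refine ⟨k, K ⧸ (Ideal.span {x} • (⊤ : Submodule R K)), inferInstance, inferInstance,
      f0.extendScalarsOfSurjective (mk_surj' x), g0.extendScalarsOfSurjective (mk_surj' x),
      ?_, ?_, ?_, ih K _ q hq (red_ker x) hxK hK⟩
    · refine (injective_iff_map_eq_zero _).mpr fun a ha => ?_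
      obtain ⟨z, rfl⟩ := hq a
      have h1 : f0 (q z) = 0 := ha
      rw [hf0, LinearMap.comp_apply] at h1
      obtain ⟨w, hw⟩ := (redPi_ker x k _).mp h1
      have h2 : g w = 0 := by
        apply hxX
        change x • g w = x • 0
        rw [← map_smul, ← hw, hfg.apply_apply_eq_zero, smul_zero]
      obtain ⟨z', rfl⟩ := (hfg w).mp h2
      rw [← map_smul] at hw
      exact (red_ker x z).mpr ⟨z', hf hw⟩
    · intro a
      obtain ⟨w, rfl⟩ := redPi_surj x k a
      constructor
      · intro ha
        have h1 : g0 (redPi x k w) = 0 := ha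
        rw [hg0, LinearMap.comp_apply] at h1
        obtain ⟨u, hu⟩ := (hker _).mp h1
        obtain ⟨w', rfl⟩ := hg u
        have h2 : g (w - x • w') = 0 := by rw [map_sub, map_smul, hu, sub_self]
        obtain ⟨z, hz⟩ := (hfg _).mp h2
        refine ⟨q z, ?_⟩
        change f0 (q z) = _
        rw [hf0, LinearMap.comp_apply, hz, map_sub, (redPi_ker x k (x • w')).mpr ⟨_, rfl⟩,
          sub_zero]
      · rintro ⟨b, hb⟩
        obtain ⟨z, rfl⟩ := hq b
        have h1 : f0 (q z) = redPi x k w := hb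
        change g0 (redPi x k w) = 0
        rw [← h1, hf0, LinearMap.comp_apply, hg0, LinearMap.comp_apply, hfg.apply_apply_eq_zero,
          map_zero]
    · intro b
      obtain ⟨z, rfl⟩ := hp b
      obtain ⟨w, rfl⟩ := hg z
      exact ⟨redPi x k w, hg0 w⟩

/-- linear map on a free module from a choice on the basis -/
theorem pi_choice {R : Type u} [CommRing R] {k : ℕ} {B : Type u} [AddCommGroup B] [Module R B]
    (b : Fin k → B) : ∃ h : (Fin k → R) →ₗ[R] B, ∀ i, h (Pi.single i 1) = b i :=
  ⟨Fintype.linearCombination R b, fun i => by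
    rw [Fintype.linearCombination_apply_single, one_smul]⟩

theorem pi_ext' {R : Type u} [CommRing R] {k : ℕ} {B : Type u} [AddCommGroup B] [Module R B]
    (h h' : (Fin k → R) →ₗ[R] B) (H : ∀ i, h (Pi.single i 1) = h' (Pi.single i 1)) (v) :
    h v = h' v := by
  rw [pi_sum h, pi_sum h']
  simp [H]

theorem lift_free {R : Type u} [CommRing R] {k : ℕ} {B C : Type u} [AddCommGroup B] [Module R B]
    [AddCommGroup C] [Module R C] (p : B →ₗ[R] C) (hp : Function.Surjective p)
    (h : (Fin k → R) →ₗ[R] C) : ∃ l : (Fin k → R) →ₗ[R] B, ∀ v, p (l v) = h v := by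
  choose b hb using fun i => hp (h (Pi.single i 1))
  obtain ⟨l, hl⟩ := pi_choice (R := R) b
  exact ⟨l, pi_ext' (p ∘ₗ l) h fun i => by simp [hl, hb]⟩

theorem e2 {R : Type u} [CommRing R] [IsNoetherianRing R] (x : R) (hx : IsSMulRegular R x)
    (n : ℕ) (X : Type u) [AddCommGroup X] [Module R X] (hX : FPD R n X) (hxX : IsSMulRegular X x) :
    ∃ y : R, IsSMulRegular (R ⧸ Ideal.span {x}) (Ideal.Quotient.mk (Ideal.span {x}) y) ∧
      ∀ (k : ℕ) (X' : Type u) [AddCommGroup X'] [Module R X'] (f : X' →ₗ[R] (Fin k → R))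
        (g : (Fin k → R) →ₗ[R] X), Function.Injective f → Function.Exact f g → Function.Surjective g →
        (∀ φ : X' →ₗ[R] R, ∃ ψ : (Fin k → R) →ₗ[R] R, ∀ z, ψ (f z) = x • φ z) →
        (∀ φ : X' →ₗ[R] R, ∃ ψ : (Fin k → R) →ₗ[R] R, ∀ z, ψ (f z) = y • φ z) := by
  let q := (Ideal.span {x} • (⊤ : Submodule R X)).mkQ
  have hq : Function.Surjective q := Submodule.mkQ_surjective _
  obtain ⟨yb, hyb, k0, a, b, hab⟩ := e1 n _ (fpd_mod x hx n X _ q hq (red_ker x) hxX hX)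
  obtain ⟨y, rfl⟩ := Ideal.Quotient.mk_surjective yb
  refine ⟨y, hyb, ?_⟩
  intro k X' _ _ f g hf hfg hg H φ
  obtain ⟨B, hB⟩ := lift_free (q ∘ₗ g) (hq.comp hg) (b.restrictScalars R ∘ₗ redPi x k0)
  obtain ⟨V, hV⟩ := lift_free (redPi x k0) (redPi_surj x k0) (a.restrictScalars R ∘ₗ q ∘ₗ g)
  simp only [LinearMap.comp_apply, LinearMap.restrictScalars_apply] at hB hV
  have hdec : ∀ w, ∃ z u, y • w = B (V w) + f z + x • u := by
    intro w
    have h1 : q (g (y • w - B (V w))) = 0 := by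
      rw [map_sub, map_sub, hB, hV, hab, map_smul, map_smul]
      exact sub_self _
    obtain ⟨v, hv⟩ := (red_ker x _).mp h1
    obtain ⟨u, rfl⟩ := hg v
    have h2 : g (y • w - B (V w) - x • u) = 0 := by rw [map_sub, hv, map_smul, sub_self]
    obtain ⟨z, hz⟩ := (hfg _).mp h2
    exact ⟨z, u, by rw [hz]; abel⟩
  choose z0 u0 hzu using fun i : Fin k => hdec (Pi.single i 1)
  obtain ⟨Z, hZ⟩ := pi_choice (R := R) z0
  obtain ⟨W, hW⟩ := pi_choice (R := R) u0
  have hd : ∀ w, y • w = B (V w) + f (Z w) + x • W w := by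
    intro w
    exact pi_ext' (y • LinearMap.id) (B ∘ₗ V + f ∘ₗ Z + x • W) (fun i => by
      simp [hZ, hW, hzu]) w
  have hc : ∀ z, ∃ c : R, x • c = y • φ z - φ (Z (f z)) := by
    intro z
    have h1 : redPi x k0 (V (f z)) = 0 := by
      rw [hV, hfg.apply_apply_eq_zero, map_zero, map_zero]
    obtain ⟨v, hv⟩ := (redPi_ker x k0 _).mp h1
    have h2 : f (y • z - Z (f z)) = x • (B v + W (f z)) := by
      rw [map_sub, map_smul, hd (f z), hv, map_smul, smul_add]; abel
    have h3 : g (B v + W (f z)) = 0 := by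
      apply hxX
      change x • _ = x • (0 : X)
      rw [← map_smul, ← h2, hfg.apply_apply_eq_zero, smul_zero]
    obtain ⟨z', hz'⟩ := (hfg _).mp h3
    rw [← hz', ← map_smul] at h2
    refine ⟨φ z', ?_⟩
    rw [← map_smul, ← map_smul, ← map_sub, hf h2]
  choose c hc using hc
  let φ' : X' →ₗ[R] R :=
    { toFun := c
      map_add' := fun z z' => hx (by
        change x • _ = x • _
        rw [smul_add, hc, hc, hc]
        simp only [map_add, smul_add]; abel)
      map_smul' := fun r z => hx (by
        change x • _ = x • _
        rw [RingHom.id_apply, smul_comm x r, hc, hc]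
        simp only [map_smul, smul_sub]
        rw [smul_comm y r]) }
  obtain ⟨ψ, hψ⟩ := H φ'
  refine ⟨ψ + φ ∘ₗ Z, fun z => ?_⟩
  have : ψ (f z) = y • φ z - φ (Z (f z)) := by rw [hψ, ← hc]; rfl
  rw [LinearMap.add_apply, this, LinearMap.comp_apply, sub_add_cancel]

end fpdmod


section trclass

variable {R : Type u} [CommRing R]

theorem fpd_fin (n : ℕ) (X : Type u) [AddCommGroup X] [Module R X] (h : FPD R n X) :
    Module.Finite R X := by
  cases n with
  | zero =>
    have : Subsingleton X := h
    infer_instance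
  | succ n =>
    obtain ⟨k, K, _, _, f, g, hf, hfg, hg, hK⟩ := h
    exact Module.Finite.of_surjective g hg

theorem fpd_kill [IsNoetherianRing R] (n : ℕ) (X : Type u) [AddCommGroup X] [Module R X]
    (h : FPD R n X) : ∃ x : R, IsSMulRegular R x ∧ (∀ e : E R X R 1, x • e = 0) ∧
      (IsSMulRegular X x → ∃ y : R, IsSMulRegular (R ⧸ Ideal.span {x})
        (Ideal.Quotient.mk (Ideal.span {x}) y) ∧ (∀ e : E R X R 1, y • e = 0)) := by
  have := fpd_fin n X h
  obtain ⟨s, hs, k0, a, b, hab⟩ := e1 n X h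
  obtain ⟨k, g, hg⟩ := Module.Finite.exists_fin' R X
  obtain ⟨l, hl⟩ := lift_free g hg b
  let f := (LinearMap.ker g).subtype
  have hf : Function.Injective f := Subtype.val_injective
  have hfg : Function.Exact f g := LinearMap.exact_subtype_ker_map g
  have H : ∀ φ : LinearMap.ker g →ₗ[R] R, ∃ ψ : (Fin k → R) →ₗ[R] R,
      ∀ z, ψ (f z) = s • φ z := by
    intro φ
    let Z : (Fin k → R) →ₗ[R] LinearMap.ker g :=
      (s • LinearMap.id - l ∘ₗ a ∘ₗ g).codRestrict (LinearMap.ker g) (fun w => by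
        simp [hl, hab])
    refine ⟨φ ∘ₗ Z, fun z => ?_⟩
    have : Z (f z) = s • z := by
      apply hf
      have h1 : f (Z (f z)) = s • f z - l (a (g (f z))) := rfl
      rw [h1, hfg.apply_apply_eq_zero, map_zero, map_zero, sub_zero, map_smul]
    rw [LinearMap.comp_apply, this, map_smul]
  refine ⟨s, hs, kill_of_ext hf hfg hg s H, fun hsX => ?_⟩
  obtain ⟨y, hy, hy2⟩ := e2 s hs n X h hsX
  exact ⟨y, hy, kill_of_ext hf hfg hg y (hy2 k _ f g hf hfg hg H)⟩

variable (R) in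
/-- finitely generated totally reflexive modules -/
structure TR (G : Type u) [AddCommGroup G] [Module R G] : Prop where
  fin : Module.Finite R G
  refl : Module.IsReflexive R G
  v1 : ∀ n, Subsingleton (E R G R (n+1))
  v2 : ∀ n, Subsingleton (E R (Module.Dual R G) R (n+1))

theorem dual_fin [IsNoetherianRing R] (G : Type u) [AddCommGroup G] [Module R G]
    [Module.Finite R G] : Module.Finite R (Module.Dual R G) := by
  infer_instance

theorem tr_pi (k : ℕ) : TR R (Fin k → R) :=
  ⟨inferInstance, inferInstance, fun n => E_proj n, fun n => E_proj n⟩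

variable {A B C : Type u} [AddCommGroup A] [Module R A] [AddCommGroup B] [Module R B]
  [AddCommGroup C] [Module R C]

theorem tr_dual [IsNoetherianRing R] (h : TR R A) : TR R (Module.Dual R A) := by
  have := h.fin
  have := h.refl
  exact ⟨inferInstance, inferInstance, h.v2, fun n => E_iso (Module.evalEquiv R A) _ (h.v1 n)⟩

theorem dual_ses {f : A →ₗ[R] B} {g : B →ₗ[R] C} (hf : Function.Injective f)
    (h : Function.Exact f g) (hg : Function.Surjective g) (hC : Subsingleton (E R C R 1)) :
    Function.Injective g.dualMap ∧ Function.Exact g.dualMap f.dualMap ∧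
      Function.Surjective f.dualMap := by
  refine ⟨LinearMap.dualMap_injective_of_surjective hg, ?_, ?_⟩
  · intro φ
    constructor
    · intro hφ
      obtain ⟨c, hc⟩ := descend g hg φ (by
        intro b hb
        obtain ⟨a, rfl⟩ := (h b).mp hb
        exact congrArg (fun q => q a) hφ)
      exact ⟨c, LinearMap.ext hc⟩
    · rintro ⟨c, rfl⟩
      ext a
      simp [h.apply_apply_eq_zero]
  · intro φ
    obtain ⟨ψ, hψ⟩ := ext_of_zero hf h hg hC φ
    exact ⟨ψ, LinearMap.ext hψ⟩

theorem refl_inj (h : Module.IsReflexive R A) (a : A) (H : ∀ φ : Module.Dual R A, φ a = 0) :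
    a = 0 := by
  apply (Module.bijective_dual_eval R A).1
  rw [map_zero]
  ext φ
  exact H φ

theorem refl_surj (h : Module.IsReflexive R A) (Φ : Module.Dual R (Module.Dual R A)) :
    ∃ a, ∀ φ : Module.Dual R A, Φ φ = φ a := by
  obtain ⟨a, rfl⟩ := (Module.bijective_dual_eval R A).2 Φ
  exact ⟨a, fun φ => rfl⟩

theorem refl_mk (h1 : ∀ a : A, (∀ φ : Module.Dual R A, φ a = 0) → a = 0)
    (h2 : ∀ Φ : Module.Dual R (Module.Dual R A), ∃ a, ∀ φ : Module.Dual R A, Φ φ = φ a) :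
    Function.Bijective (Module.Dual.eval R A) := by
  refine ⟨(injective_iff_map_eq_zero _).mpr fun a ha => h1 a fun φ =>
    congrArg (fun q => q φ) ha, fun Φ => ?_⟩
  obtain ⟨a, ha⟩ := h2 Φ
  exact ⟨a, LinearMap.ext fun φ => (ha φ).symm⟩

theorem tr_ext {f : A →ₗ[R] B} {g : B →ₗ[R] C} (hf : Function.Injective f)
    (h : Function.Exact f g) (hg : Function.Surjective g) (hA : TR R A) (hC : TR R C) :
    TR R B := by
  obtain ⟨d1, d2, d3⟩ := dual_ses hf h hg (hC.v1 0)
  have := hA.fin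
  have := hC.fin
  refine ⟨?_, ⟨refl_mk ?_ ?_⟩, fun n => c2 hf h hg _ (hA.v1 n) (hC.v1 n),
    fun n => c2 d1 d2 d3 _ (hC.v2 n) (hA.v2 n)⟩
  · exact Module.Finite.of_exact h hg
  · intro b hb
    have h1 : g b = 0 := refl_inj hC.refl _ fun φ => hb (φ ∘ₗ g)
    obtain ⟨a, rfl⟩ := (h b).mp h1
    have h2 : a = 0 := refl_inj hA.refl _ fun φ => by
      obtain ⟨ψ, rfl⟩ := d3 φ
      exact hb ψ
    rw [h2, map_zero]
  · intro Φ
    obtain ⟨c, hc⟩ := refl_surj hC.refl (Φ ∘ₗ g.dualMap)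
    obtain ⟨b, rfl⟩ := hg c
    obtain ⟨Ψ, hΨ⟩ := descend f.dualMap d3 (Φ - Module.Dual.eval R B b) (by
      intro φ hφ
      obtain ⟨ψ, rfl⟩ := (d2 φ).mp hφ
      have := hc ψ
      simp only [LinearMap.comp_apply] at this
      simp [this])
    obtain ⟨a, ha⟩ := refl_surj hA.refl Ψ
    refine ⟨b + f a, fun φ => ?_⟩
    have h1 := hΨ φ
    rw [ha] at h1
    simp only [LinearMap.sub_apply, Module.Dual.eval_apply, LinearMap.dualMap_apply] at h1
    rw [map_add, h1]; abel

theorem tr_syz [IsNoetherianRing R] {k : ℕ} {f : A →ₗ[R] (Fin k → R)} {g : (Fin k → R) →ₗ[R] C}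
    (hf : Function.Injective f)
    (h : Function.Exact f g) (hg : Function.Surjective g) (hC : TR R C) :
    TR R A := by
  obtain ⟨d1, d2, d3⟩ := dual_ses hf h hg (hC.v1 0)
  refine ⟨Module.Finite.of_injective f hf, ⟨refl_mk ?_ ?_⟩,
    fun n => c1' hf h hg _ (E_proj n) (hC.v1 (n+1)), fun n => ?_⟩
  · intro a ha
    apply hf
    ext i
    rw [map_zero]
    exact ha (LinearMap.proj i ∘ₗ f)
  · intro Φ
    obtain ⟨w, hw⟩ := refl_surj (tr_pi (R := R) k).refl (Φ ∘ₗ f.dualMap)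
    have h1 : g w = 0 := refl_inj hC.refl _ fun φ => by
      have := hw (g.dualMap φ)
      rw [LinearMap.comp_apply, d2.apply_apply_eq_zero, map_zero] at this
      exact this.symm
    obtain ⟨a, rfl⟩ := (h w).mp h1
    refine ⟨a, fun φ => ?_⟩
    obtain ⟨ψ, rfl⟩ := d3 φ
    exact hw ψ
  · cases n with
    | zero =>
      refine subsingleton_of_forall_eq 0 fun e => ?_
      have := kill_of_ext d1 d2 d3 (1 : R) (Y := R) (fun φ => ?_) e
      · simpa using this
      · obtain ⟨c, hc⟩ := refl_surj hC.refl φ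
        obtain ⟨w, rfl⟩ := hg c
        refine ⟨Module.Dual.eval R _ w, fun ψ => ?_⟩
        rw [one_smul, hc]
        rfl
    | succ n => exact c3 d1 d2 d3 _ (hC.v2 n) (E_proj _)

theorem tr_cosyz [IsNoetherianRing R] (hA : TR R A) :
    ∃ (k : ℕ) (C : Type u) (_ : AddCommGroup C) (_ : Module R C) (f : A →ₗ[R] (Fin k → R))
      (g : (Fin k → R) →ₗ[R] C), Function.Injective f ∧ Function.Exact f g ∧
      Function.Surjective g ∧ TR R C := by
  have hD := tr_dual hA
  have := hD.fin
  obtain ⟨k, p, hp⟩ := Module.Finite.exists_fin' R (Module.Dual R A)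
  have hi : Function.Exact (LinearMap.ker p).subtype p := LinearMap.exact_subtype_ker_map p
  have hΩ := tr_syz Subtype.val_injective hi hp hD
  obtain ⟨d1, d2, d3⟩ := dual_ses Subtype.val_injective hi hp (hD.v1 0)
  let e := (Pi.basisFun R (Fin k)).toDualEquiv
  refine ⟨k, _, inferInstance, inferInstance, e.symm.toLinearMap ∘ₗ p.dualMap ∘ₗ Module.Dual.eval R A,
    (LinearMap.ker p).subtype.dualMap ∘ₗ e.toLinearMap, ?_, ?_, ?_, tr_dual hΩ⟩
  · have := hA.refl
    exact e.symm.injective.comp (d1.comp (Module.bijective_dual_eval R A).1)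
  · intro w
    constructor
    · intro hw
      obtain ⟨Φ, hΦ⟩ := (d2 _).mp hw
      have := hA.refl
      obtain ⟨a, rfl⟩ := (Module.bijective_dual_eval R A).2 Φ
      refine ⟨a, ?_⟩
      change e.symm (p.dualMap (Module.Dual.eval R A a)) = w
      rw [hΦ]
      exact e.symm_apply_apply w
    · rintro ⟨a, rfl⟩
      change (LinearMap.ker p).subtype.dualMap (e (e.symm (p.dualMap (Module.Dual.eval R A a)))) = 0
      rw [e.apply_symm_apply, d2.apply_apply_eq_zero]
  · exact d3.comp e.surjective

end trclass


section approx

variable {R : Type u} [CommRing R]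

variable (R) in
/-- finite resolution by finitely generated totally reflexive modules -/
def GD : ℕ → (T : Type u) → [AddCommGroup T] → [Module R T] → Prop
  | 0, T, _, _ => TR R T
  | n + 1, T, _, _ => ∃ (A G : Type u) (_ : AddCommGroup A) (_ : Module R A)
      (_ : AddCommGroup G) (_ : Module R G) (f : A →ₗ[R] G) (g : G →ₗ[R] T),
      Function.Injective f ∧ Function.Exact f g ∧ Function.Surjective g ∧ TR R G ∧ GD n A

theorem tr_of (G : Type u) [AddCommGroup G] [Module R G] (hf : Module.Finite R G)
    (h : TotallyReflexive R G) : TR R G :=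
  ⟨hf, ⟨h.1⟩, fun n => ext_bridge R _ _ _ (h.2 (n+1) (by omega)).1,
    fun n => ext_bridge R _ _ _ (h.2 (n+1) (by omega)).2⟩

theorem gd_of [IsNoetherianRing R] (n : ℕ) : ∀ T : ModuleCat.{u} R, Module.Finite R T →
    GdimLE R n T → GD R n T := by
  induction n with
  | zero => exact fun T hT h => tr_of T hT h
  | succ n ih =>
    intro T hT h
    obtain ⟨G, g, hG, hG', hg, hK⟩ := h
    exact ⟨LinearMap.ker g, G, inferInstance, inferInstance, inferInstance, inferInstance,
      (LinearMap.ker g).subtype, g, Subtype.val_injective, LinearMap.exact_subtype_ker_map g, hg,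
      tr_of G hG hG', ih (ModuleCat.of R (LinearMap.ker g)) (inferInstanceAs (Module.Finite R (LinearMap.ker g))) hK⟩

theorem approx [IsNoetherianRing R] (n : ℕ) : ∀ (T : Type u) [AddCommGroup T] [Module R T],
    GD R n T → ∃ (m : ℕ) (P G : Type u) (_ : AddCommGroup P) (_ : Module R P)
      (_ : AddCommGroup G) (_ : Module R G) (i : T →ₗ[R] P) (j : P →ₗ[R] G),
      Function.Injective i ∧ Function.Exact i j ∧ Function.Surjective j ∧ TR R G ∧ FPD R m P := by
  induction n with
  | zero =>
    intro T _ _ h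
    obtain ⟨k, C, _, _, f, g, hf, hfg, hg, hC⟩ := tr_cosyz (A := T) h
    refine ⟨1, Fin k → R, C, inferInstance, inferInstance, inferInstance, inferInstance, f, g,
      hf, hfg, hg, hC, k, PUnit.{u+1}, inferInstance, inferInstance, 0, LinearMap.id,
      fun _ _ _ => rfl, ?_, fun w => ⟨w, rfl⟩, inferInstanceAs (Subsingleton PUnit)⟩
    intro w
    constructor
    · rintro rfl; exact ⟨0, rfl⟩
    · rintro ⟨_, rfl⟩; rfl
  | succ n ih =>
    intro T _ _ h
    obtain ⟨B, G0, _, _, _, _, f, g, hf, hfg, hg, hG0, hB⟩ := h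
    obtain ⟨m, P', G', _, _, _, _, i, j, hi, hij, hj, hG', hP'⟩ := ih B hB
    let S : Submodule R (P' × G0) := LinearMap.range (i.prod (-f))
    have hS : ∀ p w, S.mkQ (p, w) = 0 ↔ ∃ b, i b = p ∧ - f b = w := by
      intro p w
      rw [Submodule.mkQ_apply, Submodule.Quotient.mk_eq_zero]
      constructor
      · rintro ⟨b, hb⟩
        exact ⟨b, congrArg Prod.fst hb, congrArg Prod.snd hb⟩
      · rintro ⟨b, rfl, rfl⟩
        exact ⟨b, rfl⟩
    have hsplit : ∀ p w, S.mkQ (p, w) = S.mkQ (p, 0) + S.mkQ (0, w) := by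
      intro p w; rw [← map_add]; simp
    let α : G0 →ₗ[R] ((P' × G0) ⧸ S) := S.mkQ ∘ₗ LinearMap.inr R P' G0
    let γ : P' →ₗ[R] ((P' × G0) ⧸ S) := S.mkQ ∘ₗ LinearMap.inl R P' G0
    have hαγ : ∀ p w, S.mkQ (p, w) = γ p + α w := hsplit
    have hαb : ∀ b, α (f b) = γ (i b) := by
      intro b
      have h1 : S.mkQ (i b, - f b) = 0 := (hS _ _).mpr ⟨b, rfl, rfl⟩
      rw [hαγ, map_neg] at h1
      rw [← sub_eq_add_neg, sub_eq_zero] at h1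
      exact h1.symm
    obtain ⟨β, hβ⟩ := descend S.mkQ (Submodule.mkQ_surjective S)
      (j ∘ₗ LinearMap.fst R P' G0) (by
        rintro ⟨p, w⟩ hpw
        obtain ⟨b, rfl, rfl⟩ := (hS _ _).mp hpw
        exact hij.apply_apply_eq_zero b)
    have hα : Function.Injective α := by
      refine (injective_iff_map_eq_zero _).mpr fun w hw => ?_
      obtain ⟨b, hb, rfl⟩ := (hS 0 w).mp hw
      have : b = 0 := hi (by rw [hb, map_zero])
      rw [this, map_zero, neg_zero]
    have hγ : Function.Injective γ := by
      refine (injective_iff_map_eq_zero _).mpr fun w hw => ?_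
      obtain ⟨b, rfl, hb⟩ := (hS w 0).mp hw
      have : b = 0 := hf (by rw [map_zero, ← neg_eq_zero, hb])
      rw [this, map_zero]
    have hαβ : Function.Exact α β := by
      intro z
      obtain ⟨⟨p, w⟩, rfl⟩ := Submodule.mkQ_surjective S z
      constructor
      · intro hz
        rw [hβ] at hz
        obtain ⟨b, rfl⟩ := (hij p).mp hz
        exact ⟨f b + w, by rw [hαγ, map_add, hαb]⟩
      · rintro ⟨w', hw'⟩
        rw [← hw']
        exact (hβ (0, w')).trans (map_zero j)
    have hβs : Function.Surjective β := by
      intro c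
      obtain ⟨p, rfl⟩ := hj c
      exact ⟨S.mkQ (p, 0), hβ _⟩
    have hZ := tr_ext hα hαβ hβs hG0 hG'
    obtain ⟨k, C, _, _, h, l, hh, hhl, hl, hC⟩ := tr_cosyz hZ
    let Q := LinearMap.range (h ∘ₗ γ)
    have hQ : ∀ w, Q.mkQ w = 0 ↔ ∃ p, h (γ p) = w := by
      intro w
      rw [Submodule.mkQ_apply, Submodule.Quotient.mk_eq_zero]
      rfl
    obtain ⟨i', hi'⟩ := descend g hg (Q.mkQ ∘ₗ h ∘ₗ α) (by
      intro w hw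
      obtain ⟨b, rfl⟩ := (hfg w).mp hw
      exact (hQ _).mpr ⟨i b, by rw [← hαb]; rfl⟩)
    obtain ⟨j', hj'⟩ := descend Q.mkQ (Submodule.mkQ_surjective Q) l (by
      intro w hw
      obtain ⟨p, rfl⟩ := (hQ w).mp hw
      exact hhl.apply_apply_eq_zero _)
    refine ⟨m + 1, (Fin k → R) ⧸ Q, C, inferInstance, inferInstance, inferInstance, inferInstance,
      i', j', ?_, ?_, ?_, hC, k, P', inferInstance, inferInstance, h ∘ₗ γ, Q.mkQ, hh.comp hγ,
      fun w => hQ w, Submodule.mkQ_surjective Q, hP'⟩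
    · refine (injective_iff_map_eq_zero _).mpr fun t ht => ?_
      obtain ⟨w, rfl⟩ := hg t
      rw [hi'] at ht
      obtain ⟨p, hp⟩ := (hQ _).mp ht
      have h1 : S.mkQ (p, -w) = 0 := by
        rw [hαγ, map_neg, hh hp]; exact add_neg_cancel _
      obtain ⟨b, _, hb⟩ := (hS _ _).mp h1
      rw [← neg_inj.mp hb, hfg.apply_apply_eq_zero]
    · intro v
      obtain ⟨w, rfl⟩ := Submodule.mkQ_surjective Q v
      constructor
      · intro hw
        rw [hj'] at hw
        obtain ⟨z, rfl⟩ := (hhl w).mp hw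
        obtain ⟨⟨p, w⟩, rfl⟩ := Submodule.mkQ_surjective S z
        refine ⟨g w, ?_⟩
        rw [hi', hαγ, map_add, map_add, (hQ (h (γ p))).mpr ⟨p, rfl⟩, zero_add]
        rfl
      · rintro ⟨t, ht⟩
        obtain ⟨w', rfl⟩ := hg t
        rw [← ht, hi']
        exact (hj' _).trans (hhl.apply_apply_eq_zero _)
    · intro c
      obtain ⟨w, rfl⟩ := hl c
      exact ⟨Q.mkQ w, hj' w⟩

theorem gd_kill [IsNoetherianRing R] (n : ℕ) (T : Type u) [AddCommGroup T] [Module R T]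
    (h : GD R n T) : ∃ x : R, IsSMulRegular R x ∧ (∀ e : E R T R 1, x • e = 0) ∧
      (IsSMulRegular T x → ∃ y : R, IsSMulRegular (R ⧸ Ideal.span {x})
        (Ideal.Quotient.mk (Ideal.span {x}) y) ∧ (∀ e : E R T R 1, y • e = 0)) := by
  obtain ⟨m, P, G, _, _, _, _, i, j, hi, hij, hj, hG, hP⟩ := approx n T h
  obtain ⟨x, hx, hx1, hx2⟩ := fpd_kill m P hP
  refine ⟨x, hx, fun e => c1 hi hij hj 1 x hx1 (hG.v1 1) e, fun hT => ?_⟩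
  obtain ⟨y, hy, hy1⟩ := hx2 (by
    rw [isSMulRegular_iff_right_eq_zero_of_smul]
    intro p hp
    have h1 : j p = 0 := refl_inj hG.refl _ fun φ => hx (by
      change x • _ = x • (0 : R)
      rw [← map_smul, ← map_smul, hp, map_zero, map_zero, smul_zero])
    obtain ⟨t, rfl⟩ := (hij p).mp h1
    have h2 : t = 0 := hT (hi (by
      change i (x • t) = i (x • 0)
      rw [map_smul, hp, smul_zero, map_zero]))
    rw [h2, map_zero])
  exact ⟨y, hy, fun e => c1 hi hij hj 1 y hy1 (hG.v1 1) e⟩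

end approx


section final

variable {R : Type u} [CommRing R] [IsLocalRing R]

theorem depth_vanish (M : Type u) [AddCommGroup M] [Module R M] (d : ℕ)
    (h : moduleDepth R (ModuleCat.of R M) = d) (i : ℕ) (hi : i < d) :
    Subsingleton (E R (IsLocalRing.ResidueField R) M i) := by
  apply ext_bridge
  by_contra hc
  have hn := not_subsingleton_iff_nontrivial.mp hc
  have h1 : moduleDepth R (ModuleCat.of R M) ≤ (i : ℕ∞) := sInf_le ⟨i, rfl, hn⟩
  rw [h] at h1
  have := ENat.natCast_le_natCast.mp h1
  omega

theorem main [IsNoetherianRing R] {M : Type u} [AddCommGroup M] [Module R M] [Module.Finite R M] (d : ℕ)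
    (hdim : ringKrullDim R = d)
    (hd : ∀ i < d, Subsingleton (E R (IsLocalRing.ResidueField R) M i)) (n : ℕ)
    (hN : GD R n (Module.Dual R M)) : Function.Bijective (Module.Dual.eval R M) := by
  obtain ⟨k0, p, hp⟩ := Module.Finite.exists_fin' R M
  obtain ⟨k1, r, hr⟩ := Module.Finite.exists_fin' R (LinearMap.ker p)
  let δ := (LinearMap.ker p).subtype ∘ₗ r
  have hδp : Function.Exact δ p := by
    intro w
    constructor
    · intro hw
      obtain ⟨v, hv⟩ := hr ⟨w, hw⟩
      exact ⟨v, congrArg Subtype.val hv⟩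
    · rintro ⟨v, rfl⟩
      exact (r v).2
  let B := LinearMap.range δ.dualMap
  let g0 : Module.Dual R (Fin k0 → R) →ₗ[R] B := δ.dualMap.rangeRestrict
  have hD0 := tr_dual (tr_pi (R := R) k0)
  have hD1 := tr_dual (tr_pi (R := R) k1)
  have e1i : Function.Injective p.dualMap := LinearMap.dualMap_injective_of_surjective hp
  have e1e : Function.Exact p.dualMap g0 := by
    intro φ
    constructor
    · intro hφ
      have hφ' : δ.dualMap φ = 0 := congrArg Subtype.val hφ
      obtain ⟨c, hc⟩ := descend p hp φ (by
        intro b hb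
        obtain ⟨a, rfl⟩ := (hδp b).mp hb
        exact congrArg (fun q => q a) hφ')
      exact ⟨c, LinearMap.ext hc⟩
    · rintro ⟨c, rfl⟩
      ext a
      exact (congrArg c (hδp.apply_apply_eq_zero _)).trans (map_zero c)
  have e1s : Function.Surjective g0 := LinearMap.surjective_rangeRestrict _
  have e2i : Function.Injective B.subtype := Subtype.val_injective
  have e2e : Function.Exact B.subtype B.mkQ := LinearMap.exact_subtype_mkQ B
  have e2s : Function.Surjective B.mkQ := Submodule.mkQ_surjective B
  have gB : GD R (n+1) B := ⟨_, _, inferInstance, inferInstance, inferInstance, inferInstance,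
    _, _, e1i, e1e, e1s, hD0, hN⟩
  have gT : GD R (n+1+1) (Module.Dual R (Fin k1 → R) ⧸ B) :=
    ⟨_, _, inferInstance, inferInstance, inferInstance, inferInstance, _, _, e2i, e2e, e2s, hD1, gB⟩
  have hinj : ∀ m : M, (∀ φ : Module.Dual R M, φ m = 0) → m = 0 := by
    intro m hm
    obtain ⟨s, hs, hs1, _⟩ := gd_kill _ _ gT
    apply reg1 d hdim hd s hs
    obtain ⟨w, rfl⟩ := hp m
    have h0 : ∀ φ : Module.Dual R (Fin k0 → R), g0 φ = 0 →
        Module.Dual.eval R (Fin k0 → R) w φ = 0 := by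
      intro φ hφ
      obtain ⟨c, rfl⟩ := (e1e φ).mp hφ
      exact hm c
    have hq := descend (R := R) (A := Module.Dual R (Fin k0 → R)) (B := B) (C := R) g0
    obtain ⟨χ, hχ⟩ := hq e1s
      (Module.Dual.eval R (Fin k0 → R) w) h0
    obtain ⟨Ψ, hΨ⟩ := ext_of_kill (R := R) (A := B) (B := Module.Dual R (Fin k1 → R)) (Y := R)
      (C := Module.Dual R (Fin k1 → R) ⧸ B) e2i e2e e2s s hs1 χ
    obtain ⟨v, hv⟩ := refl_surj (tr_pi (R := R) k1).refl Ψ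
    have h1 : δ v = s • w := by
      rw [← sub_eq_zero]
      refine refl_inj (tr_pi (R := R) k0).refl _ fun φ => ?_
      have h2 := hΨ (g0 φ)
      rw [hχ, hv] at h2
      rw [map_sub, map_smul, sub_eq_zero]
      exact h2
    rw [← map_smul, ← h1, hδp.apply_apply_eq_zero]
  obtain ⟨x, hx, hx1, hx2⟩ := gd_kill _ _ gB
  have torsd : ∀ (X : Type u) [AddCommGroup X] [Module R X] (Φ : Module.Dual R X),
      x • Φ = 0 → Φ = 0 := by
    intro X _ _ Φ h
    ext φ
    exact hx (by simpa using congrArg (fun q => q φ) h)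
  obtain ⟨y, hy, hy1⟩ := hx2 (by
    rw [isSMulRegular_iff_right_eq_zero_of_smul]
    intro b hb
    exact Subtype.ext (torsd _ _ (congrArg Subtype.val hb)))
  have key : ∀ t : R, (∀ e : E R B R 1, t • e = 0) → ∀ Φ : Module.Dual R (Module.Dual R M),
      ∃ m, Module.Dual.eval R M m = t • Φ := by
    intro t ht Φ
    obtain ⟨Ψ, hΨ⟩ := ext_of_kill e1i e1e e1s t ht Φ
    obtain ⟨w, hw⟩ := refl_surj (tr_pi (R := R) k0).refl Ψ
    refine ⟨p w, ?_⟩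
    ext φ
    have := hΨ φ
    rw [hw] at this
    exact this
  have evi : Function.Injective (Module.Dual.eval R M) :=
    (injective_iff_map_eq_zero _).mpr fun a ha => hinj a fun φ => congrArg (fun q => q φ) ha
  let S := LinearMap.range (Module.Dual.eval R M)
  have hk : ∀ t : R, (∀ e : E R B R 1, t • e = 0) →
      ∀ c : Module.Dual R (Module.Dual R M) ⧸ S, t • c = 0 := by
    intro t ht c
    obtain ⟨Φ, rfl⟩ := S.mkQ_surjective c
    rw [← map_smul, Submodule.mkQ_apply, Submodule.Quotient.mk_eq_zero]
    exact key t ht Φ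
  have hC := reg2 (C := Module.Dual R (Module.Dual R M) ⧸ S) d hdim hd x y hx hy
    (hk x hx1) (hk y hy1)
  have hex : Function.Exact (Module.Dual.eval R M) S.mkQ := by
    intro Φ
    rw [Submodule.mkQ_apply, Submodule.Quotient.mk_eq_zero]
    rfl
  obtain ⟨ρ, hρ⟩ := ext_of_zero evi hex S.mkQ_surjective hC LinearMap.id
  refine ⟨evi, fun Φ => ⟨ρ Φ, ?_⟩⟩
  obtain ⟨m, hm⟩ := key x hx1 Φ
  rw [← sub_eq_zero]
  apply torsd
  rw [smul_sub, ← hm, ← map_smul, ← map_smul, ← hm, hρ]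
  simp

end final


end S12

theorem stmt12 (R : Type u) [CommRing R] [IsLocalRing R] [IsNoetherianRing R] (d : ℕ)
    (hCM : IsCMLocalOfDim R d)
    (M : Type u) [AddCommGroup M] [Module R M] [Module.Finite R M]
    (hMCM : moduleDepth R (ModuleCat.of R M) = d ∨ Subsingleton M)
    (hG : FiniteGdim R (M →ₗ[R] R)) :
    Function.Bijective (Module.Dual.eval R M) := by
  rcases hMCM with h | h
  · obtain ⟨n, hn⟩ := hG
    have : Module.Finite R (M →ₗ[R] R) := inferInstanceAs (Module.Finite R (Module.Dual R M))
    exact S12.main d hCM.1 (S12.depth_vanish M d h) n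
      (S12.gd_of n (ModuleCat.of R (M →ₗ[R] R)) this hn)
  · refine S12.refl_mk (fun a _ => Subsingleton.elim _ _) (fun Φ => ⟨0, fun φ => ?_⟩)
    have : φ = 0 := by ext a; rw [Subsingleton.elim a 0, map_zero, map_zero]
    rw [this, map_zero, LinearMap.zero_apply]
end

section
/- Let R be a Noetherian local ring satisfying Serre's condition (S_2), and let M be a finitely generated R-module such that for every prime p of height at most 1, Hom_{R_p}(M_p, R_p) has finite Gorenstein dimension over R_p. Then M satisfies (S_2) if and only if M is reflexive. -/
open CategoryTheory Opposite

universe u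

/-- Serre's condition `(S_2)` for a module over `R`. -/
def SerreS2 (R : Type u) [CommRing R] (M : Type u) [AddCommGroup M] [Module R M] : Prop :=
  ∀ (p : Ideal R) (hp : p.IsPrime),
    min 2 (primeHt R p hp) ≤
      moduleDepth (Localization.AtPrime p)
        (ModuleCat.of (Localization.AtPrime p) (LocalizedModule p.primeCompl M))


open CategoryTheory Opposite

section ExtPart

variable {R : Type u} [CommRing R]

lemma extMod_subsingleton_iff_exact (X Y : ModuleCat.{u} R) (P : ProjectiveResolution X) (n : ℕ) :
    Subsingleton (ExtMod R X Y n) ↔ (P.complex.linearYonedaObj R Y).ExactAt n := by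
  rw [HomologicalComplex.exactAt_iff_isZero_homology, ← ModuleCat.isZero_iff_subsingleton]
  exact (P.isoExt (R := R) n Y).isZero_iff

lemma extMod_subsingleton_succ (X Y : ModuleCat.{u} R) (P : ProjectiveResolution X) (n : ℕ) :
    Subsingleton (ExtMod R X Y (n+1)) ↔
      ∀ f : P.complex.X (n+1) ⟶ Y, P.complex.d (n+2) (n+1) ≫ f = 0 →
        ∃ g : P.complex.X n ⟶ Y, P.complex.d (n+1) n ≫ g = f := by
  rw [extMod_subsingleton_iff_exact X Y P, HomologicalComplex.exactAt_iff' _ n (n+1) (n+2)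
    (by simp) (by simp), ShortComplex.moduleCat_exact_iff]
  rfl

lemma extMod_subsingleton_zero (X Y : ModuleCat.{u} R) :
    Subsingleton (ExtMod R X Y 0) ↔ ∀ f : X ⟶ Y, f = 0 := by
  let P : ProjectiveResolution X := projectiveResolution X
  rw [extMod_subsingleton_iff_exact X Y P, HomologicalComplex.exactAt_iff' _ 0 0 1
    (by simp) (by simp), ShortComplex.moduleCat_exact_iff]
  have h1 : (∀ (x₂ : P.complex.X 0 ⟶ Y), P.complex.d 1 0 ≫ x₂ = 0 →
      ∃ x₁ : P.complex.X 0 ⟶ Y, P.complex.d 0 0 ≫ x₁ = x₂) ↔ ∀ f : X ⟶ Y, f = 0 := by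
    constructor
    · intro h f
      let p : P.complex.X 0 ⟶ X := P.π.f 0
      have hp : P.complex.d 1 0 ≫ p = 0 := P.complex_d_comp_π_f_zero
      have hep : Epi p := inferInstanceAs (Epi (P.π.f 0))
      obtain ⟨g, hg⟩ := h (p ≫ f) (by rw [← Category.assoc, hp, Limits.zero_comp])
      have h0 : P.complex.d 0 0 = 0 := P.complex.shape _ _ (by simp)
      rw [h0, Limits.zero_comp] at hg
      exact (cancel_epi p).1 (by rw [← hg, Limits.comp_zero])
    · intro h f hf
      refine ⟨0, ?_⟩
      rw [Limits.comp_zero]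
      obtain ⟨l, hl⟩ := Limits.CokernelCofork.IsColimit.desc' P.isColimitCokernelCofork f hf
      have hl0 : l = 0 := h l
      rw [← hl, hl0, Limits.comp_zero]
  exact h1

lemma extMod_subsingleton_iff (X Y : ModuleCat.{u} R) (n : ℕ) :
    Subsingleton (ExtMod R X Y n) ↔ Subsingleton (Abelian.Ext X Y n) := by
  cases n with
  | zero =>
    rw [extMod_subsingleton_zero, (Abelian.Ext.homEquiv₀ (X := X) (Y := Y)).subsingleton_congr]
    exact ⟨fun h => ⟨fun a b => by rw [h a, h b]⟩, fun h f => Subsingleton.elim _ _⟩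
  | succ n =>
    let P : ProjectiveResolution X := projectiveResolution X
    rw [extMod_subsingleton_succ X Y P]
    constructor
    · intro h
      refine subsingleton_of_forall_eq 0 fun a => ?_
      obtain ⟨f, hf, rfl⟩ := P.extMk_surjective a (n+2) rfl
      exact (P.extMk_eq_zero_iff f _ rfl hf n rfl).2 (h f hf)
    · intro h f hf
      exact (P.extMk_eq_zero_iff f _ rfl hf n rfl).1 (Subsingleton.elim _ _)

/-- Extension of maps along an injection when Ext^1 vanishes. -/
lemma ext_one_extend {S : ShortComplex (ModuleCat.{u} R)} (hS : S.ShortExact) {Y : ModuleCat.{u} R}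
    (h : Subsingleton (Abelian.Ext S.X₃ Y 1)) (φ : S.X₁ ⟶ Y) : ∃ ψ : S.X₂ ⟶ Y, S.f ≫ ψ = φ := by
  obtain ⟨x, hx⟩ := Abelian.Ext.contravariant_sequence_exact₁ hS _ (Abelian.Ext.mk₀ φ) (n₁ := 1) rfl
    (Subsingleton.elim _ _)
  obtain ⟨ψ, rfl⟩ := (Abelian.Ext.mk₀_bijective _ _).2 x
  refine ⟨ψ, ?_⟩
  rw [Abelian.Ext.mk₀_comp_mk₀] at hx
  exact (Abelian.Ext.mk₀_bijective _ _).1 hx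

lemma ext_one_of_extend {S : ShortComplex (ModuleCat.{u} R)} (hS : S.ShortExact)
    {Y : ModuleCat.{u} R} [Projective S.X₂]
    (h : ∀ (φ : S.X₁ ⟶ Y), ∃ ψ : S.X₂ ⟶ Y, S.f ≫ ψ = φ) : Subsingleton (Abelian.Ext S.X₃ Y 1) := by
  refine subsingleton_of_forall_eq 0 fun a => ?_
  obtain ⟨x, rfl⟩ := Abelian.Ext.contravariant_sequence_exact₃ hS _ a
    (Abelian.Ext.eq_zero_of_projective _) (n₀ := 0) rfl
  obtain ⟨φ, rfl⟩ := (Abelian.Ext.mk₀_bijective _ _).2 x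
  obtain ⟨ψ, rfl⟩ := h φ
  rw [← Abelian.Ext.mk₀_comp_mk₀, ← Abelian.Ext.comp_assoc_of_third_deg_zero, hS.extClass_comp,
    Abelian.Ext.zero_comp]

lemma ext_vanish_left {S : ShortComplex (ModuleCat.{u} R)} (hS : S.ShortExact)
    {Y : ModuleCat.{u} R} (n : ℕ) (h2 : Subsingleton (Abelian.Ext S.X₂ Y n))
    (h3 : Subsingleton (Abelian.Ext S.X₃ Y (n+1))) : Subsingleton (Abelian.Ext S.X₁ Y n) := by
  refine subsingleton_of_forall_eq 0 fun a => ?_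
  obtain ⟨x, rfl⟩ := Abelian.Ext.contravariant_sequence_exact₁ hS _ a (n₁ := n+1) (by omega)
    (Subsingleton.elim _ _)
  rw [Subsingleton.elim x 0, Abelian.Ext.comp_zero]

variable {X₁ X₂ X₃ Y : Type u} [AddCommGroup X₁] [AddCommGroup X₂] [AddCommGroup X₃]
  [AddCommGroup Y] [Module R X₁] [Module R X₂] [Module R X₃] [Module R Y]
  (f : X₁ →ₗ[R] X₂) (g : X₂ →ₗ[R] X₃)

lemma mod_shortExact (hf : Function.Injective f) (hfg : Function.Exact f g)
    (hg : Function.Surjective g) :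
    (ShortComplex.mk (ModuleCat.ofHom f) (ModuleCat.ofHom g)
      (by ext x; simpa using hfg.apply_apply_eq_zero x)).ShortExact :=
  ModuleCat.shortComplex_shortExact _ hfg hf hg

lemma mod_extend (hf : Function.Injective f) (hfg : Function.Exact f g)
    (hg : Function.Surjective g)
    (h : Subsingleton (ExtMod R (ModuleCat.of R X₃) (ModuleCat.of R Y) 1)) (φ : X₁ →ₗ[R] Y) :
    ∃ ψ : X₂ →ₗ[R] Y, ψ ∘ₗ f = φ := by
  rw [extMod_subsingleton_iff] at h
  obtain ⟨ψ, hψ⟩ := ext_one_extend (mod_shortExact f g hf hfg hg) h (ModuleCat.ofHom φ)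
  exact ⟨ψ.hom, by simpa using congrArg ModuleCat.Hom.hom hψ⟩

lemma mod_vanish_left (hf : Function.Injective f) (hfg : Function.Exact f g)
    (hg : Function.Surjective g) (n : ℕ)
    (h2 : Subsingleton (ExtMod R (ModuleCat.of R X₂) (ModuleCat.of R Y) n))
    (h3 : Subsingleton (ExtMod R (ModuleCat.of R X₃) (ModuleCat.of R Y) (n+1))) :
    Subsingleton (ExtMod R (ModuleCat.of R X₁) (ModuleCat.of R Y) n) := by
  rw [extMod_subsingleton_iff] at *
  exact ext_vanish_left (mod_shortExact f g hf hfg hg) n h2 h3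

lemma mod_ext_one (hf : Function.Injective f) (hfg : Function.Exact f g)
    (hg : Function.Surjective g) [Module.Projective R X₂]
    (h : ∀ (φ : X₁ →ₗ[R] Y), ∃ ψ : X₂ →ₗ[R] Y, ψ ∘ₗ f = φ) :
    Subsingleton (ExtMod R (ModuleCat.of R X₃) (ModuleCat.of R Y) 1) := by
  rw [extMod_subsingleton_iff]
  have : Projective (ModuleCat.of R X₂) := inferInstance
  refine @ext_one_of_extend _ _ _ (mod_shortExact f g hf hfg hg) _ this fun φ => ?_
  obtain ⟨ψ, hψ⟩ := h φ.hom
  exact ⟨ModuleCat.ofHom ψ, by ext x; exact LinearMap.congr_fun hψ x⟩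

end ExtPart

section Depth

variable (A : Type u) [CommRing A] [IsLocalRing A]

def DepthOne (N : Type*) [AddCommGroup N] [Module A N] : Prop :=
  ∀ n : N, (∀ r ∈ IsLocalRing.maximalIdeal A, r • n = 0) → n = 0

def DepthTwo (N : Type*) [AddCommGroup N] [Module A N] : Prop :=
  ∀ φ : IsLocalRing.maximalIdeal A →ₗ[A] N, ∃ n : N, ∀ r, φ r = (r : A) • n

variable {A} (N : Type u) [AddCommGroup N] [Module A N]

lemma ext_zero_residue : Subsingleton (ExtMod A (ModuleCat.of A (IsLocalRing.ResidueField A))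
    (ModuleCat.of A N) 0) ↔ DepthOne A N := by
  rw [extMod_subsingleton_zero]
  constructor
  · intro h n hn
    let φ : (A ⧸ IsLocalRing.maximalIdeal A) →ₗ[A] N :=
      (IsLocalRing.maximalIdeal A).liftQ (LinearMap.toSpanSingleton A N n) (by
        intro r hr; simpa using hn r hr)
    have := h (ModuleCat.ofHom φ)
    have := congrArg (fun f => ModuleCat.Hom.hom f (Submodule.Quotient.mk (1 : A))) this
    have h2 : φ (Submodule.Quotient.mk (1:A)) = 0 := this
    have h3 : φ (Submodule.Quotient.mk (1:A)) = (1 : A) • n := rfl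
    rw [h3, one_smul] at h2
    exact h2
  · intro h f
    ext x
    obtain ⟨a, rfl⟩ := IsLocalRing.residue_surjective x
    refine h _ fun r hr => ?_
    rw [← map_smul]
    have : r • (IsLocalRing.residue A a) = 0 := by
      rw [Algebra.smul_def]
      have : algebraMap A (IsLocalRing.ResidueField A) r = 0 := by
        simpa using hr
      rw [this, zero_mul]
    rw [this, map_zero]

lemma ext_one_residue : Subsingleton (ExtMod A (ModuleCat.of A (IsLocalRing.ResidueField A))
    (ModuleCat.of A N) 1) ↔ DepthTwo A N := by
  let m := IsLocalRing.maximalIdeal A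
  have hf : Function.Injective m.subtype := m.injective_subtype
  have hg : Function.Surjective (Submodule.mkQ m) := m.mkQ_surjective
  have hfg : Function.Exact m.subtype (Submodule.mkQ m) := by
    rw [LinearMap.exact_iff]; simp
  change Subsingleton (ExtMod A (ModuleCat.of A (A ⧸ m)) _ 1) ↔ _
  constructor
  · intro h φ
    obtain ⟨ψ, hψ⟩ := mod_extend _ _ hf hfg hg h φ
    refine ⟨ψ 1, fun r => ?_⟩
    rw [← map_smul, ← hψ]; simp
  · intro h
    refine mod_ext_one _ _ hf hfg hg fun φ => ?_
    obtain ⟨n, hn⟩ := h φ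
    exact ⟨LinearMap.toSpanSingleton A N n, by ext r; simp [hn]⟩

lemma one_le_depth : 1 ≤ moduleDepth A (ModuleCat.of A N) ↔ DepthOne A N := by
  rw [← ext_zero_residue, moduleDepth, le_sInf_iff]
  constructor
  · intro h
    by_contra hc
    rw [not_subsingleton_iff_nontrivial] at hc
    simpa using h 0 ⟨0, rfl, hc⟩
  · rintro h _ ⟨n, rfl, hn⟩
    cases n with
    | zero => exact absurd h (not_subsingleton_iff_nontrivial.2 hn)
    | succ n => simp

lemma two_le_depth : 2 ≤ moduleDepth A (ModuleCat.of A N) ↔ DepthOne A N ∧ DepthTwo A N := by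
  rw [← ext_zero_residue, ← ext_one_residue, moduleDepth, le_sInf_iff]
  constructor
  · intro h
    constructor
    · by_contra hc
      rw [not_subsingleton_iff_nontrivial] at hc
      simpa using h 0 ⟨0, rfl, hc⟩
    · by_contra hc
      rw [not_subsingleton_iff_nontrivial] at hc
      have := h 1 ⟨1, rfl, hc⟩
      exact absurd this (by decide)
  · rintro ⟨h0, h1⟩ _ ⟨n, rfl, hn⟩
    match n with
    | 0 => exact absurd h0 (not_subsingleton_iff_nontrivial.2 hn)
    | 1 => exact absurd h1 (not_subsingleton_iff_nontrivial.2 hn)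
    | n + 2 => push_cast; exact le_add_self

end Depth

section Local

variable {A : Type u} [CommRing A]

lemma lift_quot {Y : Type u} [AddCommGroup Y] [Module A Y]
    (h : Subsingleton (ExtMod A (ModuleCat.of A Y) (ModuleCat.of A A) 1)) (x : A)
    (hx : x ∈ nonZeroDivisors A) (g : Y →ₗ[A] (A ⧸ Ideal.span {x})) :
    ∃ l : Y →ₗ[A] A, (Submodule.mkQ (Ideal.span {x})) ∘ₗ l = g := by
  rw [extMod_subsingleton_iff] at h
  have hS := mod_shortExact (LinearMap.mulRight A x) (Submodule.mkQ (Ideal.span {x}))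
    (by
      rw [injective_iff_map_eq_zero]
      intro a ha
      exact (mem_nonZeroDivisors_iff.1 hx).2 a (by simpa using ha))
    (by
      intro y
      simp [Ideal.mem_span_singleton', Ideal.Quotient.eq_zero_iff_mem])
    (Submodule.mkQ_surjective _)
  obtain ⟨y, hy⟩ := Abelian.Ext.covariant_sequence_exact₃ (ModuleCat.of A Y) hS
    (Abelian.Ext.mk₀ (ModuleCat.ofHom g)) (n₁ := 1) rfl (Subsingleton.elim _ _)
  obtain ⟨ψ, rfl⟩ := (Abelian.Ext.mk₀_bijective _ _).2 y
  rw [Abelian.Ext.mk₀_comp_mk₀] at hy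
  have := (Abelian.Ext.mk₀_bijective _ _).1 hy
  exact ⟨ψ.hom, by simpa using congrArg ModuleCat.Hom.hom this⟩

variable [IsLocalRing A]

lemma exists_map_to {Y : Type*} [AddCommGroup Y] [Module A Y] [Module.Finite A Y]
    {I : Submodule A Y} (hI : I ≠ ⊤) {B : Type*} [AddCommGroup B] [Module A B] {b : B}
    (hb : b ≠ 0) (hm : ∀ r ∈ IsLocalRing.maximalIdeal A, r • b = 0) :
    ∃ g : Y →ₗ[A] B, g ≠ 0 ∧ ∀ y ∈ I, g y = 0 := by
  obtain ⟨J, hJ, hIJ⟩ := (eq_top_or_exists_le_coatom I).resolve_left hI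
  have hs : IsSimpleModule A (Y ⧸ J) := isSimpleModule_iff_isCoatom.2 hJ
  obtain ⟨q, hq, ⟨e⟩⟩ := isSimpleModule_iff_quot_maximal.1 hs
  obtain rfl := IsLocalRing.eq_maximalIdeal hq
  let l : (A ⧸ IsLocalRing.maximalIdeal A) →ₗ[A] B :=
    Submodule.liftQ (IsLocalRing.maximalIdeal A) (LinearMap.toSpanSingleton A B b) (by
        intro r hr; simpa using hm r hr)
  refine ⟨l ∘ₗ e.toLinearMap ∘ₗ J.mkQ, ?_, ?_⟩
  · intro h0
    obtain ⟨y, hy⟩ := J.mkQ_surjective (e.symm (Submodule.Quotient.mk (1:A)))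
    have := LinearMap.congr_fun h0 y
    have h3 : l (Submodule.Quotient.mk (1:A)) = (1 : A) • b := rfl
    simp only [LinearMap.comp_apply, hy, LinearEquiv.coe_coe, LinearEquiv.apply_symm_apply, h3,
      LinearMap.zero_apply, one_smul] at this
    exact hb this
  · intro y hy
    have : J.mkQ y = 0 := by simpa using hIJ hy
    simp only [LinearMap.comp_apply, this, map_zero]

variable [IsNoetherianRing A]

lemma exists_regular (h : DepthOne A A) :
    ∃ x ∈ IsLocalRing.maximalIdeal A, x ∈ nonZeroDivisors A := by
  by_contra hc
  push Not at hc
  have := Ideal.bot_lt_annihilator_of_disjoint_nonZeroDivisors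
    (I := IsLocalRing.maximalIdeal A) (Set.disjoint_left.2 hc)
  obtain ⟨b, hb, hb0⟩ := Submodule.exists_mem_ne_zero_of_ne_bot this.ne'
  refine hb0 (h b fun r hr => ?_)
  rw [Submodule.mem_annihilator] at hb
  have := hb r hr
  rw [smul_eq_mul, mul_comm]; exact this

lemma exists_socle {B : Type*} [AddCommGroup B] [Module A B] [Nontrivial B]
    (h : ∀ q : Ideal A, q.IsPrime → Module.annihilator A B ≤ q → q = IsLocalRing.maximalIdeal A) :
    ∃ b : B, b ≠ 0 ∧ ∀ r ∈ IsLocalRing.maximalIdeal A, r • b = 0 := by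
  obtain ⟨q, hq⟩ := associatedPrimes.nonempty A B
  rw [AssociatedPrimes.mem_iff, isAssociatedPrime_iff] at hq
  obtain ⟨hqp, b, hb⟩ := hq
  have hm : ∀ r, r ∈ q ↔ r • b = 0 := by
    intro r; rw [hb, Submodule.mem_colon_singleton]; simp
  have := h q hqp (by
    intro r hr
    exact (hm r).2 (Module.mem_annihilator.1 hr b))
  refine ⟨b, ?_, fun r hr => (hm r).1 (this ▸ hr)⟩
  rintro rfl
  exact hqp.ne_top ((Ideal.eq_top_iff_one _).2 ((hm 1).2 (by simp)))

/-- dimension at most one -/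
def DimLEOne (A : Type u) [CommRing A] [IsLocalRing A] : Prop :=
  ∀ q : Ideal A, q.IsPrime → q ≠ IsLocalRing.maximalIdeal A → q ∈ minimalPrimes A

lemma grade_key (hdim : DimLEOne A) {Y : Type u} [AddCommGroup Y] [Module A Y] [Module.Finite A Y]
    (hY : Subsingleton (ExtMod A (ModuleCat.of A Y) (ModuleCat.of A A) 1))
    (I : Submodule A Y) (hext : ∀ u : I →ₗ[A] A, ∃ u' : Y →ₗ[A] A, ∀ y : I, u' y = u y)
    (huniq : ∀ h : Y →ₗ[A] A, (∀ y ∈ I, h y = 0) → h = 0) : I = ⊤ := by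
  by_contra hI
  by_cases hd : DepthOne A A
  · obtain ⟨x, hxm, hx⟩ := exists_regular hd
    have hnt : Nontrivial (A ⧸ Ideal.span {x}) := Ideal.Quotient.nontrivial_iff.2 (by
      intro h
      rw [Ideal.span_singleton_eq_top] at h
      exact (IsLocalRing.mem_maximalIdeal x).1 hxm h)
    obtain ⟨b, hb, hm⟩ := exists_socle (A := A) (B := A ⧸ Ideal.span {x}) (by
      intro q hq hle
      by_contra hne
      rw [Ideal.annihilator_quotient, Ideal.span_singleton_le_iff_mem] at hle
      exact Set.disjoint_left.1
        (Ideal.disjoint_nonZeroDivisors_of_mem_minimalPrimes (hdim q hq hne)) hle hx)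
    obtain ⟨g, hg0, hgI⟩ := exists_map_to hI hb hm
    obtain ⟨l, hl⟩ := lift_quot hY x hx g
    have key : ∀ y : I, ∃ a : A, a * x = l y := by
      intro y
      have h1 : (Submodule.mkQ (Ideal.span {x})) (l y) = 0 := by
        rw [← LinearMap.comp_apply, hl]; exact hgI _ y.2
      rw [← LinearMap.mem_ker, Submodule.ker_mkQ] at h1
      exact Ideal.mem_span_singleton'.1 h1
    choose u hu using key
    have hreg : ∀ a b : A, a * x = b * x → a = b := fun a b hab =>
      (mul_cancel_right_mem_nonZeroDivisors hx).1 hab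
    let U : I →ₗ[A] A :=
      { toFun := u
        map_add' := fun y z => hreg _ _ (by rw [add_mul]; simp [hu])
        map_smul' := fun r y => hreg _ _ (by
          simp only [hu, smul_eq_mul, RingHom.id_apply, mul_assoc]; simp) }
    obtain ⟨u', hu'⟩ := hext U
    have h0 : l - x • u' = 0 := huniq _ (by
      intro y hy
      have h1 := hu' ⟨y, hy⟩
      have h2 := hu ⟨y, hy⟩
      simp only [U, LinearMap.coe_mk, AddHom.coe_mk] at h1
      simp only [LinearMap.sub_apply, LinearMap.smul_apply, smul_eq_mul]
      rw [h1, mul_comm, h2]; simp)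
    apply hg0
    rw [← hl, sub_eq_zero.1 h0]
    ext y
    simp only [LinearMap.comp_apply, LinearMap.smul_apply, LinearMap.zero_apply]
    rw [← LinearMap.mem_ker, Submodule.ker_mkQ]
    exact Ideal.mul_mem_right _ _ (Ideal.mem_span_singleton_self x)
  · unfold DepthOne at hd
    push Not at hd
    obtain ⟨b, hm, hb⟩ := hd
    obtain ⟨g, hg0, hgI⟩ := exists_map_to hI hb hm
    exact hg0 (huniq g hgI)

instance finite_dual' {N : Type*} [AddCommGroup N] [Module A N] [Module.Finite A N] :
    Module.Finite A (Module.Dual A N) := by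
  unfold Module.Dual
  infer_instance

/-- Half of total reflexivity. -/
def HalfTot (A : Type u) [CommRing A] (N : Type u) [AddCommGroup N] [Module A N] : Prop :=
  Function.Bijective (Module.Dual.eval A N) ∧ ∀ i : ℕ, 1 ≤ i →
    Subsingleton (ExtMod A (ModuleCat.of A (Module.Dual A N)) (ModuleCat.of A A) i)

lemma halfTot_step (hdim : DimLEOne A) {G N : Type u} [AddCommGroup G] [Module A G]
    [AddCommGroup N] [Module A N] [Module.Finite A G] [Module.Finite A N]
    (hN : Function.Injective (Module.Dual.eval A N)) (hG : HalfTot A G)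
    (g : G →ₗ[A] N) (hg : Function.Surjective g) (hK : HalfTot A (LinearMap.ker g)) :
    HalfTot A N := by
  obtain ⟨hKr, hKe⟩ := hK
  obtain ⟨hGr, hGe⟩ := hG
  let res : Module.Dual A G →ₗ[A] Module.Dual A (LinearMap.ker g) :=
    (LinearMap.ker g).subtype.dualMap
  have hmem : ∀ x : G, (∀ f : Module.Dual A G, res f = 0 → f x = 0) → x ∈ LinearMap.ker g := by
    intro x hx
    rw [LinearMap.mem_ker]
    apply hN
    ext f
    simp only [Module.Dual.eval_apply, map_zero]
    refine hx (f ∘ₗ g) ?_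
    ext k
    simp [res]
  have hsurj : LinearMap.range res = ⊤ := by
    refine grade_key hdim (hKe 1 le_rfl) _ ?_ ?_
    · intro u
      obtain ⟨x, hx⟩ := hGr.2 (u ∘ₗ res.rangeRestrict)
      have hxf : ∀ f, f x = u (res.rangeRestrict f) := fun f => LinearMap.congr_fun hx f
      have hxK : x ∈ LinearMap.ker g := hmem x (by
        intro f hf
        rw [hxf]
        have : res.rangeRestrict f = 0 := Subtype.ext hf
        rw [this, map_zero])
      refine ⟨Module.Dual.eval A _ ⟨x, hxK⟩, ?_⟩
      rintro ⟨_, f, rfl⟩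
      exact hxf f
    · intro h hh
      obtain ⟨k, rfl⟩ := hKr.2 h
      have : k = 0 := by
        apply Subtype.ext
        apply hGr.1
        ext f
        have := hh (res f) ⟨f, rfl⟩
        simpa [res] using this
      rw [this, map_zero]
  have hsurj' : Function.Surjective res := LinearMap.range_eq_top.1 hsurj
  have hinj : Function.Injective g.dualMap := LinearMap.dualMap_injective_of_surjective hg
  have hex : Function.Exact g.dualMap res := by
    intro f
    constructor
    · intro hf
      refine ⟨(LinearMap.ker g).liftQ f ?_ ∘ₗ
        (g.quotKerEquivOfSurjective hg).symm.toLinearMap, ?_⟩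
      · intro k hk
        exact LinearMap.congr_fun hf ⟨k, hk⟩
      · ext x
        have : (g.quotKerEquivOfSurjective hg).symm (g x) = Submodule.Quotient.mk x := by
          rw [LinearEquiv.symm_apply_eq]; rfl
        simp [LinearMap.dualMap_apply, this]
        rfl
    · rintro ⟨f, rfl⟩
      ext k
      simp [res]
  refine ⟨⟨hN, ?_⟩, ?_⟩
  · intro y
    obtain ⟨z, hz⟩ := mod_extend _ _ hinj hex hsurj' (hKe 1 le_rfl) y
    obtain ⟨x, rfl⟩ := hGr.2 z
    refine ⟨g x, ?_⟩
    rw [← hz]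
    ext f
    simp
  · intro i hi
    exact mod_vanish_left _ _ hinj hex hsurj' i (hGe i hi) (hKe (i+1) (by omega))

lemma gdim_halfTot (hdim : DimLEOne A) (n : ℕ) : ∀ (N : ModuleCat.{u} A) [Module.Finite A N],
    Function.Injective (Module.Dual.eval A N) → GdimLE A n N → HalfTot A N := by
  induction n with
  | zero =>
    intro N _ _ h
    exact ⟨h.1, fun i hi => (h.2 i hi).2⟩
  | succ n ih =>
    rintro N _ hN ⟨G, g, hGf, hG, hg, hK⟩
    have hG' : HalfTot A G := ⟨hG.1, fun i hi => (hG.2 i hi).2⟩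
    refine halfTot_step hdim hN hG' g hg ?_
    refine ih (ModuleCat.of A (LinearMap.ker g)) ?_ hK
    intro k k' hkk
    apply Subtype.ext
    apply hG.1.1
    ext f
    exact LinearMap.congr_fun hkk (f ∘ₗ (LinearMap.ker g).subtype)

lemma eval_dual_injective {R : Type*} [CommRing R] {X : Type*} [AddCommGroup X] [Module R X] :
    Function.Injective (Module.Dual.eval R (Module.Dual R X)) := by
  intro f f' h
  ext x
  exact LinearMap.congr_fun h (Module.Dual.eval R X x)

lemma local_main (hdim : DimLEOne A) {X : Type u} [AddCommGroup X] [Module A X] [Module.Finite A X]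
    (h : FiniteGdim A (X →ₗ[A] A)) : Function.Surjective (Module.Dual.eval A X) ∧
      ∀ u : LinearMap.ker (Module.Dual.eval A X) →ₗ[A] A, u = 0 := by
  obtain ⟨n, hn⟩ := h
  have hfin : Module.Finite A (ModuleCat.of A (X →ₗ[A] A)) :=
    inferInstanceAs (Module.Finite A (Module.Dual A X))
  have hP : HalfTot A (Module.Dual A X) :=
    gdim_halfTot hdim n (ModuleCat.of A (X →ₗ[A] A)) eval_dual_injective hn
  have hs : Function.Surjective (Module.Dual.eval A X) := by
    rw [← LinearMap.range_eq_top]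
    refine grade_key hdim (hP.2 1 le_rfl) _ ?_ ?_
    · intro u
      refine ⟨Module.Dual.eval A _ (u ∘ₗ (Module.Dual.eval A X).rangeRestrict), ?_⟩
      rintro ⟨_, x, rfl⟩
      rfl
    · intro h hh
      obtain ⟨f, rfl⟩ := hP.1.2 h
      have : f = 0 := by
        ext x
        exact hh _ ⟨x, rfl⟩
      rw [this, map_zero]
  refine ⟨hs, fun u => ?_⟩
  obtain ⟨w, rfl⟩ := mod_extend (LinearMap.ker (Module.Dual.eval A X)).subtype
    (Module.Dual.eval A X) (Submodule.injective_subtype _)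
    (by rw [LinearMap.exact_iff]; simp) hs (hP.2 1 le_rfl) u
  ext k
  exact LinearMap.congr_fun (LinearMap.mem_ker.1 k.2) w

lemma local_inj (hdim : ∀ q : Ideal A, q.IsPrime → q = IsLocalRing.maximalIdeal A)
    {K : Type*} [AddCommGroup K] [Module A K] [Module.Finite A K]
    (h : ∀ u : K →ₗ[A] A, u = 0) : Subsingleton K := by
  obtain ⟨b, hb, hm⟩ := exists_socle (A := A) (B := A) fun q hq _ => hdim q hq
  by_contra hc
  rw [not_subsingleton_iff_nontrivial] at hc
  obtain ⟨g, hg, -⟩ := exists_map_to (Y := K) (I := ⊥) bot_ne_top hb hm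
  exact hg (h g)

end Local

section Transfer

variable {A : Type u} [CommRing A] [IsLocalRing A]

lemma DepthOne.congr {N N' : Type*} [AddCommGroup N] [Module A N] [AddCommGroup N'] [Module A N']
    (e : N ≃ₗ[A] N') (h : DepthOne A N) : DepthOne A N' := by
  intro n hn
  have := h (e.symm n) (fun r hr => by rw [← map_smul, hn r hr, map_zero])
  simpa using this

lemma DepthTwo.congr {N N' : Type*} [AddCommGroup N] [Module A N] [AddCommGroup N'] [Module A N']
    (e : N ≃ₗ[A] N') (h : DepthTwo A N) : DepthTwo A N' := by
  intro φ
  obtain ⟨n, hn⟩ := h (e.symm.toLinearMap ∘ₗ φ)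
  refine ⟨e n, fun r => ?_⟩
  rw [← map_smul, ← hn r]
  simp

lemma DepthOne.dual {N : Type*} [AddCommGroup N] [Module A N] (h : DepthOne A A) :
    DepthOne A (Module.Dual A N) := by
  intro f hf
  ext x
  exact h (f x) (fun r hr => by rw [← LinearMap.smul_apply, hf r hr]; rfl)

lemma DepthTwo.dual {N : Type*} [AddCommGroup N] [Module A N] (h : DepthOne A A)
    (h2 : DepthTwo A A) : DepthTwo A (Module.Dual A N) := by
  intro φ
  have hx : ∀ x : N, ∃ a : A, ∀ r, φ r x = (r : A) • a := fun x =>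
    h2 ((LinearMap.applyₗ x : (N →ₗ[A] A) →ₗ[A] A) ∘ₗ φ)
  choose g hg using hx
  have uniq : ∀ a b : A, (∀ r : IsLocalRing.maximalIdeal A, (r : A) • a = (r : A) • b) → a = b := by
    intro a b hab
    refine sub_eq_zero.mp (h _ fun r hr => ?_)
    rw [smul_sub, hab ⟨r, hr⟩, sub_self]
  refine ⟨{ toFun := g, map_add' := ?_, map_smul' := ?_ }, fun r => ?_⟩
  · intro x y
    refine uniq _ _ fun r => ?_
    rw [smul_add, ← hg, ← hg, ← hg, map_add]
  · intro c x
    refine uniq _ _ fun r => ?_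
    rw [← hg, map_smul, hg, RingHom.id_apply, smul_comm]
  · ext x
    exact hg x r

lemma mem_range_of_depth {X Y : Type*} [AddCommGroup X] [Module A X] [AddCommGroup Y] [Module A Y]
    (F : X →ₗ[A] Y) (hF : Function.Injective F) (hY : DepthOne A Y) (hX : DepthTwo A X)
    (y : Y) (hy : ∀ r ∈ IsLocalRing.maximalIdeal A, r • y ∈ LinearMap.range F) :
    y ∈ LinearMap.range F := by
  let ψ : IsLocalRing.maximalIdeal A →ₗ[A] LinearMap.range F :=
    LinearMap.codRestrict _ ((LinearMap.toSpanSingleton A Y y).comp (Submodule.subtype _))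
      (fun r => hy r r.2)
  obtain ⟨n, hn⟩ := hX ((LinearEquiv.ofInjective F hF).symm.toLinearMap ∘ₗ ψ)
  refine ⟨n, sub_eq_zero.mp (hY _ fun r hr => ?_)⟩
  have h1 := congrArg (LinearEquiv.ofInjective F hF) (hn ⟨r, hr⟩)
  have h2 := congrArg Subtype.val h1
  have h3 : r • y = r • F n := by
    rw [LinearMap.comp_apply, LinearEquiv.coe_coe, LinearEquiv.apply_symm_apply, map_smul] at h2
    exact h2
  rw [smul_sub, h3, sub_self]

lemma min_two_le_iff (h d : ℕ∞) : min 2 h ≤ d ↔ (1 ≤ h → 1 ≤ d) ∧ (2 ≤ h → 2 ≤ d) := by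
  constructor
  · intro H
    exact ⟨fun h1 => le_trans (le_min (by norm_num) h1) H, fun h2 => le_trans (le_min le_rfl h2) H⟩
  · rintro ⟨H1, H2⟩
    rcases le_or_gt 2 h with h2 | h2
    · exact (min_le_left _ _).trans (H2 h2)
    · refine (min_le_right _ _).trans ?_
      have h1 : h ≤ 1 := Order.le_of_lt_add_one (by simpa [one_add_one_eq_two] using h2)
      rcases eq_or_ne h 0 with h0 | h0
      · simp [h0]
      · exact h1.trans (H1 (Order.one_le_iff_ne_zero.mpr h0))

end Transfer

section Loc

variable {R : Type u} [CommRing R] (p : Ideal R) [hp : p.IsPrime]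

lemma krullDim_atPrime : ringKrullDim (Localization.AtPrime p) = primeHt R p hp := by
  rw [IsLocalization.AtPrime.ringKrullDim_eq_height p, primeHt, ← PrimeSpectrum.height_eq_orderHeight]

lemma dimLEOne_of_ht (h : primeHt R p hp ≤ 1) : DimLEOne (Localization.AtPrime p) := by
  have : Ring.KrullDimLE 1 (Localization.AtPrime p) := by
    rw [Ring.krullDimLE_iff, krullDim_atPrime]
    exact_mod_cast h
  intro q hq hne
  rcases Ring.krullDimLE_one_iff.mp this q hq with h | h
  · exact h
  · exact absurd (IsLocalRing.eq_maximalIdeal h) hne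

lemma dimZero_of_ht (h : primeHt R p hp = 0) (q : Ideal (Localization.AtPrime p)) (hq : q.IsPrime) :
    q = IsLocalRing.maximalIdeal _ := by
  have : Ring.KrullDimLE 0 (Localization.AtPrime p) := by
    rw [Ring.krullDimLE_iff, krullDim_atPrime, h]
    simp
  exact IsLocalRing.eq_maximalIdeal (Ring.krullDimLE_zero_iff.mp this q hq)

lemma serreS2_iff (M : Type u) [AddCommGroup M] [Module R M] : SerreS2 R M ↔
    ∀ (p : Ideal R) (hp : p.IsPrime),
      (1 ≤ primeHt R p hp → DepthOne (Localization.AtPrime p) (LocalizedModule p.primeCompl M)) ∧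
      (2 ≤ primeHt R p hp → DepthTwo (Localization.AtPrime p) (LocalizedModule p.primeCompl M)) := by
  refine forall_congr' fun p => forall_congr' fun hp => ?_
  rw [min_two_le_iff, one_le_depth, two_le_depth]
  constructor
  · exact fun h => ⟨h.1, fun h2 => (h.2 h2).2⟩
  · exact fun h => ⟨h.1, fun h2 => ⟨h.1 (le_trans (by norm_num) h2), h.2 h2⟩⟩

noncomputable def selfLocEquiv : LocalizedModule p.primeCompl R ≃ₗ[Localization.AtPrime p] Localization.AtPrime p :=
  (IsLocalizedModule.linearEquiv p.primeCompl (LocalizedModule.mkLinearMap p.primeCompl R)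
    (Algebra.linearMap R (Localization.AtPrime p))).extendScalarsOfIsLocalization
      p.primeCompl (Localization.AtPrime p)

variable [IsNoetherianRing R] (M : Type u) [AddCommGroup M] [Module R M] [Module.Finite R M]

noncomputable abbrev locD : Module.Dual R M →ₗ[R]
    Module.Dual (Localization.AtPrime p) (LocalizedModule p.primeCompl M) :=
  IsLocalizedModule.mapExtendScalars p.primeCompl (LocalizedModule.mkLinearMap p.primeCompl M)
    (Algebra.linearMap R (Localization.AtPrime p)) (Localization.AtPrime p)

instance finPresLoc (N : Type u) [AddCommGroup N] [Module R N] [Module.Finite R N] :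
    Module.FinitePresentation R N := Module.finitePresentation_of_finite R N

instance : IsLocalizedModule p.primeCompl (locD p M) :=
  Module.FinitePresentation.isLocalizedModule_mapExtendScalars _ _ _ _

noncomputable abbrev locD2 : Module.Dual R (Module.Dual R M) →ₗ[R]
    Module.Dual (Localization.AtPrime p)
      (Module.Dual (Localization.AtPrime p) (LocalizedModule p.primeCompl M)) :=
  IsLocalizedModule.mapExtendScalars p.primeCompl (locD p M)
    (Algebra.linearMap R (Localization.AtPrime p)) (Localization.AtPrime p)

instance [Module.Finite R (Module.Dual R M)] : IsLocalizedModule p.primeCompl (locD2 p M) :=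
  Module.FinitePresentation.isLocalizedModule_mapExtendScalars _ _ _ _

lemma locD_apply (f : Module.Dual R M) (m : M) :
    locD p M f (LocalizedModule.mkLinearMap p.primeCompl M m)
      = algebraMap R (Localization.AtPrime p) (f m) := by
  simp [locD, -LocalizedModule.mkLinearMap_apply]

lemma locD2_apply (y : Module.Dual R (Module.Dual R M)) (f : Module.Dual R M) :
    locD2 p M y (locD p M f) = algebraMap R (Localization.AtPrime p) (y f) := by
  change IsLocalizedModule.map p.primeCompl (locD p M) (Algebra.linearMap R (Localization.AtPrime p)) y (locD p M f) = _
  rw [IsLocalizedModule.map_apply]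
  rfl

lemma locD2_eval (m : M) : locD2 p M (Module.Dual.eval R M m) =
    Module.Dual.eval (Localization.AtPrime p) _ (LocalizedModule.mkLinearMap p.primeCompl M m) := by
  apply LinearMap.restrictScalars_injective R
  refine IsLocalizedModule.ext p.primeCompl (locD p M)
    (IsLocalizedModule.map_units (Algebra.linearMap R (Localization.AtPrime p))) ?_
  ext f
  change locD2 p M _ (locD p M f) = locD p M f (LocalizedModule.mkLinearMap p.primeCompl M m)
  rw [locD2_apply, locD_apply]
  rfl

variable [Module.Finite R (Module.Dual R M)]

lemma map_eval : IsLocalizedModule.map p.primeCompl (LocalizedModule.mkLinearMap p.primeCompl M)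
    (locD2 p M) (Module.Dual.eval R M) =
    (Module.Dual.eval (Localization.AtPrime p)
      (LocalizedModule p.primeCompl M)).restrictScalars R := by
  refine IsLocalizedModule.ext p.primeCompl (LocalizedModule.mkLinearMap p.primeCompl M)
    (IsLocalizedModule.map_units (locD2 p M)) ?_
  ext1 m
  rw [LinearMap.comp_apply, IsLocalizedModule.map_apply, locD2_eval]
  rfl

lemma eval_loc_injective (h : Function.Injective (Module.Dual.eval R M)) :
    Function.Injective (Module.Dual.eval (Localization.AtPrime p)
      (LocalizedModule p.primeCompl M)) := by
  have := IsLocalizedModule.map_injective p.primeCompl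
    (LocalizedModule.mkLinearMap p.primeCompl M) (locD2 p M) _ h
  rwa [map_eval] at this

lemma eval_loc_surjective (h : Function.Surjective (Module.Dual.eval R M)) :
    Function.Surjective (Module.Dual.eval (Localization.AtPrime p)
      (LocalizedModule p.primeCompl M)) := by
  have := IsLocalizedModule.map_surjective p.primeCompl
    (LocalizedModule.mkLinearMap p.primeCompl M) (locD2 p M) _ h
  rwa [map_eval] at this

lemma mem_range_descend (y : Module.Dual R (Module.Dual R M))
    (h : locD2 p M y ∈ LinearMap.range (Module.Dual.eval (Localization.AtPrime p)
      (LocalizedModule p.primeCompl M))) :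
    ∃ t ∈ p.primeCompl, t • y ∈ LinearMap.range (Module.Dual.eval R M) := by
  obtain ⟨x, hx⟩ := h
  obtain ⟨⟨m, s⟩, hms⟩ := IsLocalizedModule.surj p.primeCompl
    (LocalizedModule.mkLinearMap p.primeCompl M) x
  have h1 : locD2 p M (s • y) = locD2 p M (Module.Dual.eval R M m) := by
    rw [locD2_eval, ← hms, Submonoid.smul_def, Submonoid.smul_def, map_smul, ← hx]
    exact (LinearMap.map_smul_of_tower _ _ _).symm
  obtain ⟨c, hc⟩ := IsLocalizedModule.exists_of_eq (S := p.primeCompl) h1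
  refine ⟨c * s, (c * s).2, c • m, ?_⟩
  rw [Submonoid.smul_def, map_smul, mul_smul]
  exact hc.symm

lemma locD2_smul_mem (y : Module.Dual R (Module.Dual R M))
    (h : ∀ r ∈ p, r • y ∈ LinearMap.range (Module.Dual.eval R M)) :
    ∀ a ∈ IsLocalRing.maximalIdeal (Localization.AtPrime p),
      a • locD2 p M y ∈ LinearMap.range (Module.Dual.eval (Localization.AtPrime p)
        (LocalizedModule p.primeCompl M)) := by
  intro a ha
  rw [← Localization.AtPrime.map_eq_maximalIdeal] at ha
  have : Ideal.map (algebraMap R (Localization.AtPrime p)) p ≤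
      Submodule.comap (LinearMap.toSpanSingleton (Localization.AtPrime p) _ (locD2 p M y))
        (LinearMap.range (Module.Dual.eval (Localization.AtPrime p)
        (LocalizedModule p.primeCompl M))) := by
    rw [Ideal.map_le_iff_le_comap]
    intro r hr
    obtain ⟨m, hm⟩ := h r hr
    refine ⟨LocalizedModule.mkLinearMap p.primeCompl M m, ?_⟩
    rw [← locD2_eval, hm, LinearMap.toSpanSingleton_apply, map_smul, algebraMap_smul]
  exact this ha

lemma mk_killed (k : M) (h : ∀ r ∈ p, r • k = 0) :
    ∀ a ∈ IsLocalRing.maximalIdeal (Localization.AtPrime p),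
      a • LocalizedModule.mkLinearMap p.primeCompl M k = 0 := by
  intro a ha
  rw [← Localization.AtPrime.map_eq_maximalIdeal] at ha
  have : Ideal.map (algebraMap R (Localization.AtPrime p)) p ≤
      LinearMap.ker (LinearMap.toSpanSingleton (Localization.AtPrime p) _
        (LocalizedModule.mkLinearMap p.primeCompl M k)) := by
    rw [Ideal.map_le_iff_le_comap]
    intro r hr
    rw [Ideal.mem_comap, LinearMap.mem_ker, LinearMap.toSpanSingleton_apply]
    rw [algebraMap_smul, ← map_smul, h r hr, map_zero]
  exact this ha

end Loc

section Main

variable {R : Type u} [CommRing R] [IsNoetherianRing R]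

lemma exists_ass (N : Type*) [AddCommGroup N] [Module R N] [Nontrivial N] :
    ∃ p : Ideal R, p.IsPrime ∧ ∃ x : N, ∀ r : R, r ∈ p ↔ r • x = 0 := by
  obtain ⟨p, hp⟩ := associatedPrimes.nonempty R N
  rw [AssociatedPrimes.mem_iff, isAssociatedPrime_iff] at hp
  obtain ⟨h1, x, hx⟩ := hp
  refine ⟨p, h1, x, fun r => ?_⟩
  rw [hx, Submodule.mem_colon_singleton, Submodule.mem_bot]

lemma backward [IsLocalRing R] (hS2 : SerreS2 R R)
    (M : Type u) [AddCommGroup M] [Module R M] [Module.Finite R M]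
    (hb : Function.Bijective (Module.Dual.eval R M)) : SerreS2 R M := by
  rw [serreS2_iff] at hS2 ⊢
  intro p hp
  let e := LinearEquiv.ofBijective (Module.Dual.eval (Localization.AtPrime p)
      (LocalizedModule p.primeCompl M))
      ⟨eval_loc_injective p M hb.1, eval_loc_surjective p M hb.2⟩
  obtain ⟨h1, h2⟩ := hS2 p hp
  refine ⟨fun h => ?_, fun h => ?_⟩
  · exact ((h1 h).congr (selfLocEquiv p)).dual.congr e.symm
  · exact (DepthTwo.dual ((h1 (le_trans (by norm_num) h)).congr (selfLocEquiv p))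
      ((h2 h).congr (selfLocEquiv p))).congr e.symm

lemma forward [IsLocalRing R] (hS2 : SerreS2 R R)
    (M : Type u) [AddCommGroup M] [Module R M] [Module.Finite R M]
    (hG : ∀ (p : Ideal R) (hp : p.IsPrime), primeHt R p hp ≤ 1 →
      FiniteGdim (Localization.AtPrime p)
        ((LocalizedModule p.primeCompl M) →ₗ[Localization.AtPrime p] (Localization.AtPrime p)))
    (hM : SerreS2 R M) : Function.Bijective (Module.Dual.eval R M) := by
  rw [serreS2_iff] at hS2 hM
  have hfin : ∀ (p : Ideal R) [p.IsPrime], Module.Finite (Localization.AtPrime p)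
      (LocalizedModule p.primeCompl M) := fun p _ => Module.Finite.of_isLocalizedModule
        p.primeCompl (LocalizedModule.mkLinearMap p.primeCompl M)
  have hinj : Function.Injective (Module.Dual.eval R M) := by
    rw [← LinearMap.ker_eq_bot]
    by_contra hne
    have := Submodule.nontrivial_iff_ne_bot.mpr hne
    obtain ⟨p, hp, ⟨k, hk⟩, hpk⟩ := exists_ass (R := R) (LinearMap.ker (Module.Dual.eval R M))
    have hpk' : ∀ r : R, r ∈ p ↔ r • k = 0 := fun r => by
      rw [hpk]; simp [Subtype.ext_iff]
    have hk0 : LocalizedModule.mkLinearMap p.primeCompl M k ≠ 0 := by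
      intro h0
      rw [IsLocalizedModule.eq_zero_iff p.primeCompl] at h0
      obtain ⟨c, hc⟩ := h0
      exact c.2 ((hpk' c).mpr hc)
    have hd : ¬ DepthOne (Localization.AtPrime p) (LocalizedModule p.primeCompl M) := fun hd =>
      hk0 (hd _ (mk_killed p M k fun r hr => (hpk' r).mp hr))
    have ht : primeHt R p hp = 0 := by
      by_contra h
      exact hd ((hM p hp).1 (Order.one_le_iff_ne_zero.mpr h))
    have hle : primeHt R p hp ≤ 1 := by simp [ht]
    have hloc := local_main (dimLEOne_of_ht p hle) (hG p hp hle)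
    have hsub := local_inj (dimZero_of_ht p ht) hloc.2
    have hmem : LocalizedModule.mkLinearMap p.primeCompl M k ∈ LinearMap.ker
        (Module.Dual.eval (Localization.AtPrime p) (LocalizedModule p.primeCompl M)) := by
      rw [LinearMap.mem_ker, ← locD2_eval, LinearMap.mem_ker.mp hk, map_zero]
    exact hk0 (congrArg Subtype.val (Subsingleton.elim (⟨_, hmem⟩ : LinearMap.ker
        (Module.Dual.eval (Localization.AtPrime p) (LocalizedModule p.primeCompl M))) 0))
  refine ⟨hinj, ?_⟩
  rw [← LinearMap.range_eq_top]
  by_contra hne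
  have := Submodule.Quotient.nontrivial_iff.mpr hne
  obtain ⟨p, hp, c, hpc⟩ := exists_ass (R := R)
    (Module.Dual R (Module.Dual R M) ⧸ LinearMap.range (Module.Dual.eval R M))
  obtain ⟨y, rfl⟩ := Submodule.Quotient.mk_surjective _ c
  have hpy : ∀ r : R, r ∈ p ↔ r • y ∈ LinearMap.range (Module.Dual.eval R M) := fun r => by
    rw [hpc, ← Submodule.Quotient.mk_smul, Submodule.Quotient.mk_eq_zero]
  have key : locD2 p M y ∈ LinearMap.range (Module.Dual.eval (Localization.AtPrime p)
      (LocalizedModule p.primeCompl M)) := by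
    rcases le_or_gt 2 (primeHt R p hp) with h2 | h2
    · have h1 : 1 ≤ primeHt R p hp := le_trans (by norm_num) h2
      exact mem_range_of_depth _ (eval_loc_injective p M hinj)
        (((hS2 p hp).1 h1).congr (selfLocEquiv p)).dual ((hM p hp).2 h2) _
        (locD2_smul_mem p M y fun r hr => (hpy r).mp hr)
    · have hle : primeHt R p hp ≤ 1 :=
        Order.le_of_lt_add_one (by simpa [one_add_one_eq_two] using h2)
      exact (local_main (dimLEOne_of_ht p hle) (hG p hp hle)).1 _
  obtain ⟨t, ht, hty⟩ := mem_range_descend p M y key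
  exact ht ((hpy t).mpr hty)

end Main

theorem stmt13 (R : Type u) [CommRing R] [IsLocalRing R] [IsNoetherianRing R]
    (hS2 : SerreS2 R R)
    (M : Type u) [AddCommGroup M] [Module R M] [Module.Finite R M]
    (hG : ∀ (p : Ideal R) (hp : p.IsPrime), primeHt R p hp ≤ 1 →
      FiniteGdim (Localization.AtPrime p)
        ((LocalizedModule p.primeCompl M) →ₗ[Localization.AtPrime p] (Localization.AtPrime p))) :
    SerreS2 R M ↔ Function.Bijective (Module.Dual.eval R M) := by
  exact ⟨forward hS2 M hG, backward hS2 M⟩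
end

section
/- Let R be a complete Cohen-Macaulay local ring with canonical module ω, and let M be a nonzero finitely generated R-module with G-dim_R(Hom_R(M,R)) < ∞. If Ext^i_R(M,R) = 0 for all 1 ≤ i ≤ dim(R), then Hom_R(M,R) is a totally reflexive R-module and M is maximal Cohen-Macaulay. -/
open CategoryTheory Opposite

universe u

open CategoryTheory Opposite Limits

lemma bridge (R : Type u) [CommRing R] (X Y : ModuleCat.{u} R) (n : ℕ) :
    Subsingleton (ExtMod R X Y n) ↔ Subsingleton (Abelian.Ext.{u} X Y n) := by
  obtain ⟨P⟩ := (inferInstance : HasProjectiveResolution X).out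
  have e1 : Subsingleton (ExtMod R X Y n) ↔
      Subsingleton ((P.complex.linearYonedaObj R Y).homology n) :=
    (P.isoExt n Y).toLinearEquiv.toEquiv.subsingleton_congr
  rw [e1, ← ModuleCat.isZero_iff_subsingleton, ← HomologicalComplex.exactAt_iff_isZero_homology]
  cases n with
  | zero => 
    rw [HomologicalComplex.exactAt_iff' _ 0 0 1 (by simp) (by simp), ShortComplex.moduleCat_exact_iff]
    constructor
    · intro h
      refine subsingleton_of_forall_eq 0 fun a => ?_
      obtain ⟨f, hf, rfl⟩ := P.extMk_surjective a 1 rfl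
      obtain ⟨g, hg⟩ := h f hf
      have : f = 0 := by
        rw [← hg]
        simp
        rfl
      subst this
      simp
    · intro h f hf
      refine ⟨0, ?_⟩
      have := Abelian.Ext.homEquiv₀ (X := X) (Y := Y) |>.symm.subsingleton
      obtain ⟨l, hl⟩ := CokernelCofork.IsColimit.desc' P.isColimitCokernelCofork f hf
      have hl0 : l = 0 := by
        refine (cancel_epi (HomologicalComplex.singleObjXSelf (ComplexShape.down ℕ) 0 X).inv).1 ?_
        exact Subsingleton.elim (α := X ⟶ Y) _ _
      rw [hl0, comp_zero] at hl
      rw [map_zero]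
      exact hl
  | succ n => 
    rw [HomologicalComplex.exactAt_iff' _ n (n+1) (n+2) (by simp) (by simp), ShortComplex.moduleCat_exact_iff]
    constructor
    · intro h
      refine subsingleton_of_forall_eq 0 fun a => ?_
      obtain ⟨f, hf, rfl⟩ := P.extMk_surjective a (n+2) rfl
      obtain ⟨g, hg⟩ := h f hf
      exact (P.extMk_eq_zero_iff f (n+2) rfl hf n rfl).2 ⟨g, hg⟩
    · intro h f hf
      exact (P.extMk_eq_zero_iff f (n+2) rfl hf n rfl).1 (Subsingleton.elim _ _)


section Infra

variable {R : Type u} [CommRing R]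
variable {A B C N : Type u} [AddCommGroup A] [Module R A] [AddCommGroup B] [Module R B]
  [AddCommGroup C] [Module R C] [AddCommGroup N] [Module R N]

/-- Shorthand for the Yoneda-style Ext groups. -/
abbrev EE (R : Type u) [CommRing R] (A B : Type u) [AddCommGroup A] [Module R A]
    [AddCommGroup B] [Module R B] (n : ℕ) : Type u :=
  Abelian.Ext.{u} (ModuleCat.of R A) (ModuleCat.of R B) n

/-- Functoriality in the second variable. -/
noncomputable def push (f : A →ₗ[R] B) {n : ℕ} (a : EE R N A n) : EE R N B n :=
  a.comp (Abelian.Ext.mk₀ (ModuleCat.ofHom f)) (add_zero n)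

lemma push_push (f : A →ₗ[R] B) (g : B →ₗ[R] C) {n : ℕ} (a : EE R N A n) :
    push g (push f a) = push (g ∘ₗ f) a := by
  simp only [push]
  rw [Abelian.Ext.comp_assoc_of_third_deg_zero, Abelian.Ext.mk₀_comp_mk₀, ModuleCat.ofHom_comp]

lemma push_id {n : ℕ} (a : EE R N A n) : push (LinearMap.id) a = a := by
  simp [push]

lemma push_add (f g : A →ₗ[R] B) {n : ℕ} (a : EE R N A n) :
    push (f + g) a = push f a + push g a := by
  simp only [push]
  rw [← Abelian.Ext.comp_add, ← Abelian.Ext.mk₀_add]; rfl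

lemma push_smul (r : R) (f : A →ₗ[R] B) {n : ℕ} (a : EE R N A n) :
    push (r • f) a = r • push f a := by
  simp only [push]
  rw [← Abelian.Ext.comp_smul, ← Abelian.Ext.mk₀_smul]; rfl

lemma push_add_right (f : A →ₗ[R] B) {n : ℕ} (a b : EE R N A n) :
    push f (a + b) = push f a + push f b := by
  simp [push]

lemma push_zero_right (f : A →ₗ[R] B) {n : ℕ} :
    push f (0 : EE R N A n) = 0 := by
  simp [push]

/-- `push` as a linear map in the homomorphism. -/
noncomputable def pushL (a : EE R N A n) : (A →ₗ[R] B) →ₗ[R] EE R N B n where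
  toFun f := push f a
  map_add' f g := push_add f g a
  map_smul' r f := push_smul r f a

/-- `push` as an additive map in the Ext class. -/
noncomputable def pushR (f : A →ₗ[R] B) (n : ℕ) : EE R N A n →+ EE R N B n where
  toFun a := push f a
  map_zero' := push_zero_right f
  map_add' a b := push_add_right f a b

/-- Short exactness, unbundled. -/
structure SE (i : A →ₗ[R] B) (p : B →ₗ[R] C) : Prop where
  inj : Function.Injective i
  surj : Function.Surjective p
  ex : Function.Exact i p

lemma SE.comp {i : A →ₗ[R] B} {p : B →ₗ[R] C} (h : SE i p) : p ∘ₗ i = 0 :=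
  h.ex.linearMap_comp_eq_zero

lemma SE.shortExact {i : A →ₗ[R] B} {p : B →ₗ[R] C} (h : SE i p) :
    (ShortComplex.mk (ModuleCat.ofHom i) (ModuleCat.ofHom p)
      (by rw [← ModuleCat.ofHom_comp, h.comp]; rfl)).ShortExact where
  exact := (ShortComplex.ShortExact.moduleCat_exact_iff_function_exact _).2 h.ex
  mono_f := (ModuleCat.mono_iff_injective _).2 h.inj
  epi_g := (ModuleCat.epi_iff_surjective _).2 h.surj

variable {i : A →ₗ[R] B} {p : B →ₗ[R] C}

lemma SE.con3 (h : SE i p) {n : ℕ} (h1 : Subsingleton (EE R A N n))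
    (h2 : Subsingleton (EE R B N (n+1))) : Subsingleton (EE R C N (n+1)) := by
  refine subsingleton_of_forall_eq 0 fun x => ?_
  obtain ⟨y, hy⟩ := Abelian.Ext.contravariant_sequence_exact₃ h.shortExact _ x
    (Subsingleton.elim (α := EE R B N (n+1)) _ _) (add_comm 1 n)
  rw [← hy, show y = 0 from Subsingleton.elim (α := EE R A N n) _ _, Abelian.Ext.comp_zero]

lemma SE.con1 (h : SE i p) {n : ℕ} (h1 : Subsingleton (EE R B N n))
    (h2 : Subsingleton (EE R C N (n+1))) : Subsingleton (EE R A N n) := by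
  refine subsingleton_of_forall_eq 0 fun x => ?_
  obtain ⟨y, hy⟩ := Abelian.Ext.contravariant_sequence_exact₁ h.shortExact _ x
    (add_comm 1 n) (Subsingleton.elim (α := EE R C N (n+1)) _ _)
  rw [← hy, show y = 0 from Subsingleton.elim (α := EE R B N n) _ _, Abelian.Ext.comp_zero]

lemma SE.extend (h : SE i p) (h2 : Subsingleton (EE R C N 1)) (f : A →ₗ[R] N) :
    ∃ g : B →ₗ[R] N, g ∘ₗ i = f := by
  obtain ⟨y, hy⟩ := Abelian.Ext.contravariant_sequence_exact₁ h.shortExact _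
    (Abelian.Ext.mk₀ (ModuleCat.ofHom f))
    (add_comm 1 0) (Subsingleton.elim (α := EE R C N 1) _ _)
  obtain ⟨g, rfl⟩ := (Abelian.Ext.mk₀_bijective _ _).2 y
  rw [Abelian.Ext.mk₀_comp_mk₀] at hy
  have := (Abelian.Ext.mk₀_bijective _ _).1 hy
  exact ⟨g.hom, congrArg ModuleCat.Hom.hom this⟩

lemma SE.ext_one (h : SE i p) (h1 : Subsingleton (EE R B N 1))
    (he : ∀ f : A →ₗ[R] N, ∃ g : B →ₗ[R] N, g ∘ₗ i = f) : Subsingleton (EE R C N 1) := by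
  refine subsingleton_of_forall_eq 0 fun x => ?_
  obtain ⟨y, hy⟩ := Abelian.Ext.contravariant_sequence_exact₃ h.shortExact _ x
    (Subsingleton.elim (α := EE R B N 1) _ _) (add_comm 1 0)
  obtain ⟨f, rfl⟩ := (Abelian.Ext.mk₀_bijective _ _).2 y
  obtain ⟨g, hg⟩ := he f.hom
  have : f = ModuleCat.ofHom i ≫ ModuleCat.ofHom g := by
    refine ModuleCat.hom_ext ?_
    exact hg.symm
  rw [← hy, this, ← Abelian.Ext.mk₀_comp_mk₀]
  exact h.shortExact.extClass_comp_assoc _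

lemma SE.cov1 (h : SE i p) {n : ℕ} (h1 : ∀ j, j < n → Subsingleton (EE R N C j))
    (a : EE R N A n) (ha : push i a = 0) : a = 0 := by
  cases n with
  | zero =>
    have := h.shortExact.mono_f
    exact Abelian.Ext.postcomp_mk₀_injective_of_mono _ (ModuleCat.ofHom i)
      (ha.trans (push_zero_right (N := N) i).symm)
  | succ n =>
    obtain ⟨y, hy⟩ := Abelian.Ext.covariant_sequence_exact₁ _ h.shortExact a ha rfl
    have := h1 n (by omega)
    rw [← hy, show y = 0 from Subsingleton.elim (α := EE R N C n) _ _, Abelian.Ext.zero_comp]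

lemma SE.cov2 (h : SE i p) {n : ℕ} 
    (b : EE R N B n) (hb : push p b = 0) : ∃ a : EE R N A n, push i a = b :=
  Abelian.Ext.covariant_sequence_exact₂ _ h.shortExact b hb

lemma ext_proj [Module.Projective R A] (n : ℕ) : Subsingleton (EE R A N (n+1)) :=
  subsingleton_of_forall_eq 0 fun x => by
    have : Projective (ModuleCat.of R A) := (IsProjective.iff_projective A).1 inferInstance
    exact Abelian.Ext.eq_zero_of_projective x

lemma ext_congr (e : A ≃ₗ[R] B) {n : ℕ} (h : Subsingleton (EE R A N n)) :
    Subsingleton (EE R B N n) := by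
  refine subsingleton_of_forall_eq 0 fun x => ?_
  have h0 : (Abelian.Ext.mk₀ (ModuleCat.ofHom e.toLinearMap)).comp x (zero_add n) = 0 :=
    Subsingleton.elim (α := EE R A N n) _ _
  have h1 := Abelian.Ext.mk₀_comp_mk₀_assoc (ModuleCat.ofHom e.symm.toLinearMap)
    (ModuleCat.ofHom e.toLinearMap) x
  rw [h0, Abelian.Ext.comp_zero] at h1
  rw [← ModuleCat.ofHom_comp, LinearEquiv.comp_symm] at h1
  exact (h1.trans (Abelian.Ext.mk₀_id_comp x)).symm

/-- `Ext` vanishing below `a`. -/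
def DGE (R : Type u) [CommRing R] (K : Type u) [AddCommGroup K] [Module R K] (a : ℕ)
   (X : Type u) [AddCommGroup X] [Module R X] : Prop :=
  ∀ j, j < a → Subsingleton (EE R K X j)

lemma SE.dge (h : SE i p) {n : ℕ} (hB : DGE R N (n+1) B) (hC : DGE R N n C) :
    DGE R N (n+1) A := by
  intro j hj
  refine subsingleton_of_forall_eq 0 fun a => ?_
  have := hB j hj
  exact h.cov1 (fun l hl => hC l (by omega)) a (Subsingleton.elim _ _)

lemma DGE.mono {n m : ℕ} (h : DGE R N n A) (hm : m ≤ n) : DGE R N m A :=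
  fun j hj => h j (by omega)

lemma SE.dge' (h : SE i p) {n : ℕ} (hB : DGE R N n B) (hC : DGE R N n C) :
    DGE R N n A := by
  cases n with
  | zero => intro j hj; omega
  | succ n => exact h.dge hB (hC.mono (by omega))

end Infra


section TRSec

variable {R : Type u} [CommRing R]
variable {A B C : Type u} [AddCommGroup A] [Module R A] [AddCommGroup B] [Module R B]
  [AddCommGroup C] [Module R C]

/-- Totally reflexive, with Yoneda Ext. -/
structure TRf (R : Type u) [CommRing R] (A : Type u) [AddCommGroup A] [Module R A] : Prop where
  bij : Function.Bijective (Module.Dual.eval R A)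
  extA : ∀ n, Subsingleton (EE R A R (n+1))
  extD : ∀ n, Subsingleton (EE R (Module.Dual R A) R (n+1))

lemma trf_iff : TRf R A ↔ TotallyReflexive R A := by
  constructor
  · intro h
    refine ⟨h.bij, fun i hi => ?_⟩
    obtain ⟨n, rfl⟩ : ∃ n, i = n + 1 := ⟨i - 1, by omega⟩
    exact ⟨(bridge _ _ _ _).2 (h.extA n), (bridge _ _ _ _).2 (h.extD n)⟩
  · intro h
    exact ⟨h.1, fun n => (bridge _ _ _ _).1 (h.2 (n+1) (by omega)).1,
      fun n => (bridge _ _ _ _).1 (h.2 (n+1) (by omega)).2⟩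

lemma trf_free (F : Type u) [AddCommGroup F] [Module R F] [Module.Finite R F] [Module.Free R F] :
    TRf R F :=
  ⟨Module.bijective_dual_eval R F, fun n => ext_proj n, fun n => ext_proj n⟩

variable {i : A →ₗ[R] B} {p : B →ₗ[R] C}

lemma exact_transpose (hp : Function.Surjective p) (hex : Function.Exact i p) :
    Function.Exact (Module.Dual.transpose (R := R) p) (Module.Dual.transpose (R := R) i) := by
  intro f
  constructor
  · intro hf
    have hf' : ∀ x, f (i x) = 0 := fun x => LinearMap.congr_fun hf x
    let e : (B ⧸ LinearMap.ker p) ≃ₗ[R] C := p.quotKerEquivOfSurjective hp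
    have hk : LinearMap.ker p ≤ LinearMap.ker f := by
      intro x hx
      obtain ⟨y, rfl⟩ := (hex x).1 hx
      exact hf' y
    refine ⟨(Submodule.liftQ _ f hk) ∘ₗ e.symm.toLinearMap, ?_⟩
    ext x
    have : e.symm (p x) = Submodule.Quotient.mk x := by
      rw [LinearEquiv.symm_apply_eq]; rfl
    change (Submodule.liftQ _ f hk) (e.symm (p x)) = f x
    rw [this]; rfl
  · rintro ⟨g, rfl⟩
    ext x
    change g (p (i x)) = 0
    rw [hex.apply_apply_eq_zero, map_zero]

lemma SE.dual (h : SE i p) (he : ∀ f : A →ₗ[R] R, ∃ g : B →ₗ[R] R, g ∘ₗ i = f) :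
    SE (Module.Dual.transpose (R := R) p) (Module.Dual.transpose (R := R) i) where
  inj := LinearMap.dualMap_injective_of_surjective h.surj
  surj := he
  ex := exact_transpose h.surj h.ex

lemma SE.trf (h : SE i p) (hA : TRf R A) (hB : TRf R B)
    (he : ∀ f : A →ₗ[R] R, ∃ g : B →ₗ[R] R, g ∘ₗ i = f) : TRf R C where
  extA n := by
    cases n with
    | zero => exact h.ext_one (hB.extA 0) he
    | succ n => exact h.con3 (hA.extA n) (hB.extA (n+1))
  extD n := (h.dual he).con1 (hB.extD n) (hA.extD (n+1))
  bij := by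
    have hd := h.dual he
    constructor
    · rw [injective_iff_map_eq_zero]
      intro x hx
      obtain ⟨b, rfl⟩ := h.surj x
      have hx' : ∀ f : Module.Dual R C, f (p b) = 0 := fun f => LinearMap.congr_fun hx f
      -- factor through the dual of `A`
      have hk : LinearMap.ker (Module.Dual.transpose (R := R) i) ≤
          LinearMap.ker (Module.Dual.eval R B b) := by
        intro g hg
        obtain ⟨f, rfl⟩ := (hd.ex g).1 hg
        exact hx' f
      let e := (Module.Dual.transpose (R := R) i).quotKerEquivOfSurjective hd.surj
      obtain ⟨a, ha⟩ := hA.bij.2 ((Submodule.liftQ _ _ hk) ∘ₗ e.symm.toLinearMap)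
      have : b = i a := by
        apply hB.bij.1
        ext g
        have h2 := LinearMap.congr_fun ha (g ∘ₗ i)
        have h3 : e.symm (g ∘ₗ i) = Submodule.Quotient.mk g := by
          rw [LinearEquiv.symm_apply_eq]; rfl
        change g (i a) = (Submodule.liftQ _ _ hk) (e.symm (g ∘ₗ i)) at h2
        rw [h3] at h2
        exact h2.symm
      rw [this]
      exact h.ex.apply_apply_eq_zero a
    · intro ξ
      obtain ⟨ζ, hζ⟩ := hd.extend (hA.extD 0) ξ
      obtain ⟨b, rfl⟩ := hB.bij.2 ζ
      exact ⟨p b, hζ⟩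

lemma SE.mkQ (j : A →ₗ[R] B) (hj : Function.Injective j) : SE j (LinearMap.range j).mkQ :=
  ⟨hj, Submodule.mkQ_surjective _, LinearMap.exact_map_mkQ_range j⟩

lemma TRf.cosyz [IsNoetherianRing R] [Module.Finite R A] (h : TRf R A) :
    ∃ (s : ℕ) (j : A →ₗ[R] (Fin s → R)), Function.Injective j ∧
      (∀ f : A →ₗ[R] R, ∃ g : (Fin s → R) →ₗ[R] R, g ∘ₗ j = f) ∧
      TRf R ((Fin s → R) ⧸ LinearMap.range j) := by
  obtain ⟨s, π, hπ⟩ := Module.Finite.exists_fin' R (Module.Dual R A)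
  let j : A →ₗ[R] (Fin s → R) := LinearMap.pi fun l => π (Pi.single l 1)
  have hjπ : ∀ v a, π v a = ∑ l, v l * j a l := by
    intro v a
    conv_lhs => rw [pi_eq_sum_univ' v]
    simp [j]
  have he : ∀ f : A →ₗ[R] R, ∃ g : (Fin s → R) →ₗ[R] R, g ∘ₗ j = f := by
    intro f
    obtain ⟨v, rfl⟩ := hπ f
    refine ⟨∑ l, v l • LinearMap.proj l, ?_⟩
    ext a
    rw [hjπ]
    simp
  have hj : Function.Injective j := by
    rw [injective_iff_map_eq_zero]
    intro a ha
    apply h.bij.1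
    ext f
    obtain ⟨g, rfl⟩ := he f
    simp [ha]
  exact ⟨s, j, hj, he, (SE.mkQ j hj).trf h (trf_free _) he⟩

end TRSec


section Eta

variable {R : Type u} [CommRing R]
variable {A B C : Type u} [AddCommGroup A] [Module R A] [AddCommGroup B] [Module R B]
  [AddCommGroup C] [Module R C]
variable (K : Type u) [AddCommGroup K] [Module R K] (d : ℕ)

/-- The natural map `Ext^d(K,A) → Hom(A*, Ext^d(K,R))` is injective. -/
def EInj (R : Type u) [CommRing R] (K : Type u) [AddCommGroup K] [Module R K] (d : ℕ)
    (A : Type u) [AddCommGroup A] [Module R A] : Prop :=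
  ∀ a : EE R K A d, (∀ f : A →ₗ[R] R, push f a = 0) → a = 0

/-- The natural map `Ext^d(K,A) → Hom(A*, Ext^d(K,R))` is surjective. -/
def ESurj (R : Type u) [CommRing R] (K : Type u) [AddCommGroup K] [Module R K] (d : ℕ)
    (A : Type u) [AddCommGroup A] [Module R A] : Prop :=
  ∀ φ : Module.Dual R A →ₗ[R] EE R K R d, ∃ a : EE R K A d, ∀ f : A →ₗ[R] R, push f a = φ f

variable {K d}

lemma push_sum_single {s : ℕ} {n : ℕ} (a : EE R K (Fin s → R) n) :
    a = ∑ l, push (LinearMap.single R (fun _ : Fin s => R) l) (push (LinearMap.proj l) a) := by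
  have h : (LinearMap.id : (Fin s → R) →ₗ[R] (Fin s → R)) =
      ∑ l, (LinearMap.single R (fun _ : Fin s => R) l) ∘ₗ (LinearMap.proj l) := by
    ext l m
    simp [Pi.single_apply]
  calc a = push LinearMap.id a := (push_id a).symm
    _ = pushL a (LinearMap.id) := rfl
    _ = _ := by rw [h, map_sum]; simp only [push_push]; rfl

lemma dge_free (hd : DGE R K d R) (s : ℕ) : DGE R K d (Fin s → R) := by
  intro n hn
  refine subsingleton_of_forall_eq 0 fun a => ?_
  have := hd n hn
  rw [push_sum_single a]
  refine Finset.sum_eq_zero fun l _ => ?_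
  rw [show push (LinearMap.proj l) a = 0 from Subsingleton.elim (α := EE R K R n) _ _,
    push_zero_right]

lemma einj_free (s : ℕ) : EInj R K d (Fin s → R) := by
  intro a ha
  rw [push_sum_single a]
  refine Finset.sum_eq_zero fun l _ => ?_
  rw [ha, push_zero_right]

lemma esurj_free (s : ℕ) : ESurj R K d (Fin s → R) := by
  intro φ
  refine ⟨∑ l, push (LinearMap.single R (fun _ : Fin s => R) l) (φ (LinearMap.proj l)), ?_⟩
  intro f
  have h0 : push f (∑ l, push (LinearMap.single R (fun _ : Fin s => R) l) (φ (LinearMap.proj l)))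
      = ∑ l, push (f ∘ₗ LinearMap.single R (fun _ : Fin s => R) l) (φ (LinearMap.proj l)) := by
    change pushR f d _ = _
    rw [map_sum]
    refine Finset.sum_congr rfl fun l _ => ?_
    exact push_push _ _ _
  have h1 : f = ∑ l, f (Pi.single l 1) • (LinearMap.proj l : (Fin s → R) →ₗ[R] R) := by
    ext l
    simp [Pi.single_apply]
  rw [h0]
  conv_rhs => rw [h1, map_sum]
  refine Finset.sum_congr rfl fun l _ => ?_
  rw [map_smul]
  have h2 : f ∘ₗ LinearMap.single R (fun _ : Fin s => R) l =
      f (Pi.single l 1) • LinearMap.id := by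
    ext; simp
  rw [h2, push_smul, push_id]

variable {i : A →ₗ[R] B} {p : B →ₗ[R] C}

lemma SE.einj (h : SE i p) (hC : DGE R K d C) (hB : EInj R K d B) : EInj R K d A := by
  intro a ha
  refine h.cov1 hC a (hB _ fun f => ?_)
  rw [push_push]; exact ha _

lemma SE.esurj (h : SE i p) (hB : ESurj R K d B) (hC : EInj R K d C)
    (he : ∀ f : A →ₗ[R] R, ∃ g : B →ₗ[R] R, g ∘ₗ i = f) : ESurj R K d A := by
  intro φ
  obtain ⟨b, hb⟩ := hB (φ ∘ₗ Module.Dual.transpose (R := R) i)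
  obtain ⟨a, rfl⟩ := h.cov2 b (hC _ fun f => by
    rw [push_push, hb]
    have : Module.Dual.transpose (R := R) i (f ∘ₗ p) = 0 := by
      change (f ∘ₗ p) ∘ₗ i = 0
      rw [LinearMap.comp_assoc, h.comp, LinearMap.comp_zero]
    rw [LinearMap.comp_apply, this, map_zero])
  refine ⟨a, fun f => ?_⟩
  obtain ⟨g, rfl⟩ := he f
  rw [← push_push, hb]
  rfl

variable [IsNoetherianRing R]

lemma TRf.dge (hd : DGE R K d R) (n : ℕ) (hn : n ≤ d) (A : Type u) [AddCommGroup A] [Module R A]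
    [Module.Finite R A] (h : TRf R A) : DGE R K n A := by
  induction n generalizing A with
  | zero => intro j hj; omega
  | succ n ih =>
    obtain ⟨s, j, hj, he, hC⟩ := h.cosyz
    exact (SE.mkQ j hj).dge ((dge_free hd s).mono hn) (ih (by omega) _ hC)

lemma TRf.einj (hd : DGE R K d R) [Module.Finite R A] (h : TRf R A) : EInj R K d A := by
  obtain ⟨s, j, hj, he, hC⟩ := h.cosyz
  exact (SE.mkQ j hj).einj (TRf.dge hd d le_rfl _ hC) (einj_free s)

lemma TRf.esurj (hd : DGE R K d R) [Module.Finite R A] (h : TRf R A) : ESurj R K d A := by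
  obtain ⟨s, j, hj, he, hC⟩ := h.cosyz
  exact (SE.mkQ j hj).esurj (esurj_free s) (hC.einj hd) he

end Eta

section Local

variable {R : Type u} [CommRing R] [IsLocalRing R] [IsNoetherianRing R]
variable {A B C : Type u} [AddCommGroup A] [Module R A] [AddCommGroup B] [Module R B]
  [AddCommGroup C] [Module R C] {d : ℕ}

open IsLocalRing

lemma smul_ext_zero (r : R) (hr : r ∈ maximalIdeal R)
    (x : EE R (ResidueField R) A d) : r • x = 0 := by
  have h0 : r • (𝟙 (ModuleCat.of R (ResidueField R))) = 0 := by
    refine ModuleCat.hom_ext ?_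
    refine LinearMap.ext fun x => ?_
    change r • (x : ResidueField R) = 0
    rw [Algebra.smul_def]
    have : algebraMap R (ResidueField R) r = 0 := (residue_eq_zero_iff r).2 hr
    rw [this, zero_mul]
  rw [← Abelian.Ext.mk₀_id_comp x, ← Abelian.Ext.smul_comp, ← Abelian.Ext.mk₀_smul, h0,
    Abelian.Ext.mk₀_zero, Abelian.Ext.zero_comp]

lemma exists_hom (hE : ¬ Subsingleton (EE R (ResidueField R) R d))
    (T : Type u) [AddCommGroup T] [Module R T] [Module.Finite R T] (N : Submodule R T)
    (hN : N ≠ ⊤) : ∃ φ : T →ₗ[R] EE R (ResidueField R) R d, φ ≠ 0 ∧ ∀ x ∈ N, φ x = 0 := by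
  obtain ⟨N', hN', hle⟩ := (eq_top_or_exists_le_coatom N).resolve_left hN
  have hs : IsSimpleModule R (T ⧸ N') := isSimpleModule_iff_isCoatom.2 hN'
  obtain ⟨I, hI, ⟨e⟩⟩ := isSimpleModule_iff_quot_maximal.1 hs
  have hIm : I = maximalIdeal R := eq_maximalIdeal hI
  rw [not_subsingleton_iff_nontrivial] at hE
  obtain ⟨ε, hε⟩ := exists_ne (0 : EE R (ResidueField R) R d)
  let ψ : (R ⧸ I) →ₗ[R] EE R (ResidueField R) R d :=
    Submodule.liftQ I (LinearMap.toSpanSingleton R _ ε) (by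
      intro r hr
      exact smul_ext_zero r (hIm ▸ hr) ε)
  refine ⟨ψ ∘ₗ e.toLinearMap ∘ₗ N'.mkQ, ?_, ?_⟩
  · intro h
    obtain ⟨t, ht⟩ := N'.mkQ_surjective (e.symm (Submodule.Quotient.mk 1))
    have := LinearMap.congr_fun h t
    apply hε
    simp only [LinearMap.comp_apply, ht, LinearEquiv.coe_coe, LinearEquiv.apply_symm_apply] at this
    have h2 : (1 : R) • ε = 0 := this
    rwa [one_smul] at h2
  · intro x hx
    have : N'.mkQ x = 0 := by simpa using hle hx
    simp [LinearMap.comp_apply, this]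

variable {i : A →ₗ[R] B} {p : B →ₗ[R] C}

lemma SE.trf_of_depth (h : SE i p) (hd : DGE R (ResidueField R) d R)
    (hE : ¬ Subsingleton (EE R (ResidueField R) R d)) [Module.Finite R A] [Module.Finite R B]
    (hA : TRf R A) (hB : TRf R B) (hC : DGE R (ResidueField R) d C) : TRf R C := by
  refine h.trf hA hB ?_
  by_contra hne
  have hr : LinearMap.range (Module.Dual.transpose (R := R) i) ≠ ⊤ := by
    intro ht
    exact hne (LinearMap.range_eq_top.1 ht)
  obtain ⟨φ, hφ, hφ0⟩ := exists_hom hE _ _ hr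
  obtain ⟨a, ha⟩ := hA.esurj hd φ
  have : a = 0 := h.cov1 hC a (hB.einj hd _ fun g => by
    rw [push_push, ha]
    exact hφ0 _ ⟨g, rfl⟩)
  apply hφ
  ext f
  rw [← ha, this, push_zero_right]; rfl

lemma trf_of_gdim (hd : DGE R (ResidueField R) d R)
    (hE : ¬ Subsingleton (EE R (ResidueField R) R d)) (n : ℕ) (X : ModuleCat.{u} R)
    (hX : GdimLE R n X) (hdX : DGE R (ResidueField R) d X) : TRf R X := by
  induction n generalizing X with
  | zero => exact trf_iff.2 hX
  | succ n ih =>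
    obtain ⟨G, g, hfin, hG, hg, hk⟩ := hX
    have hs : SE (LinearMap.ker g).subtype g :=
      ⟨Submodule.subtype_injective _, hg, LinearMap.exact_subtype_ker_map g⟩
    have hG' : TRf R G := trf_iff.2 hG
    have hL : TRf R (LinearMap.ker g) := ih _ hk (hs.dge' (TRf.dge hd d le_rfl G hG') hdX)
    exact hs.trf_of_depth hd hE hL hG' hdX

end Local


section Final

variable {R : Type u} [CommRing R]

lemma SE.of_exact {X Y Z W : Type u} [AddCommGroup X] [Module R X] [AddCommGroup Y] [Module R Y]
    [AddCommGroup Z] [Module R Z] [AddCommGroup W] [Module R W]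
    (a : X →ₗ[R] Y) (b : Y →ₗ[R] Z) (c : Z →ₗ[R] W) (hab : Function.Exact a b)
    (hbc : Function.Exact b c) (hc : Function.Surjective c) :
    SE ((LinearMap.range a).liftQ b (by
      rintro _ ⟨x, rfl⟩
      exact hab.apply_apply_eq_zero x)) c where
  surj := hc
  inj := by
    rw [injective_iff_map_eq_zero]
    intro y hy
    obtain ⟨y, rfl⟩ := Submodule.mkQ_surjective _ y
    obtain ⟨x, rfl⟩ := (hab y).1 hy
    simp
  ex := by
    intro z
    rw [hbc z]
    constructor
    · rintro ⟨y, rfl⟩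
      exact ⟨Submodule.Quotient.mk y, rfl⟩
    · rintro ⟨y, rfl⟩
      obtain ⟨y, rfl⟩ := Submodule.mkQ_surjective _ y
      exact ⟨y, rfl⟩

lemma exists_cover [IsNoetherianRing R] {A B : Type u} [AddCommGroup A] [Module R A]
    [AddCommGroup B] [Module R B] [Module.Finite R A] (f : A →ₗ[R] B) :
    ∃ (r : ℕ) (ψ : (Fin r → R) →ₗ[R] A), Function.Exact ψ f := by
  obtain ⟨r, π, hπ⟩ := Module.Finite.exists_fin' R (LinearMap.ker f)
  refine ⟨r, (LinearMap.ker f).subtype ∘ₗ π, fun y => ⟨fun hy => ?_, ?_⟩⟩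
  · obtain ⟨v, hv⟩ := hπ ⟨y, hy⟩
    exact ⟨v, by simp [hv]⟩
  · rintro ⟨v, rfl⟩
    exact (π v).2

variable {K : Type u} [AddCommGroup K] [Module R K] {d : ℕ}

lemma depth_tr [IsNoetherianRing R] (hd : DGE R K d R) (a : ℕ) (ha : a ≤ d) (s t : ℕ)
    (M : Type u) [AddCommGroup M] [Module R M]
    (φ : (Fin s → R) →ₗ[R] (Fin t → R)) (p : (Fin t → R) →ₗ[R] M) (hp : Function.Surjective p)
    (hex : Function.Exact φ p) (hM : ∀ n, n < a → Subsingleton (EE R M R (n+1))) :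
    DGE R K a (Module.Dual R (Fin s → R) ⧸
      LinearMap.range (Module.Dual.transpose (R := R) φ)) := by
  induction a generalizing s t M with
  | zero => intro j hj; omega
  | succ a ih =>
    obtain ⟨r, ψ, hψ⟩ := exists_cover φ
    have h1 := SE.of_exact ψ φ p hψ hex hp
    have h2 := ih (by omega) r s _ ψ (LinearMap.range ψ).mkQ (Submodule.mkQ_surjective _)
      (LinearMap.exact_map_mkQ_range ψ)
      (fun n hn => h1.con1 (ext_proj n) (hM (n+1) (by omega)))
    have hex2 : Function.Exact (Module.Dual.transpose (R := R) φ)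
        (Module.Dual.transpose (R := R) ψ) := by
      intro f
      constructor
      · intro hf
        have hf' : ∀ x, f (ψ x) = 0 := fun x => LinearMap.congr_fun hf x
        obtain ⟨g, hg⟩ := h1.extend (hM 0 (by omega)) ((LinearMap.range ψ).liftQ f (by
          rintro _ ⟨x, rfl⟩
          exact hf' x))
        refine ⟨g, LinearMap.ext fun x => ?_⟩
        exact LinearMap.congr_fun hg (Submodule.Quotient.mk x)
      · rintro ⟨g, rfl⟩
        refine LinearMap.ext fun x => ?_
        change g (φ (ψ x)) = 0
        rw [hψ.apply_apply_eq_zero, map_zero]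
    have h3 := SE.of_exact _ _ _ hex2
      (LinearMap.exact_map_mkQ_range (Module.Dual.transpose (R := R) ψ))
      (Submodule.mkQ_surjective _)
    exact h3.dge ((TRf.dge hd d le_rfl _ (trf_free _)).mono ha) h2

lemma moduleDepth_eq_iff [IsLocalRing R] (X : Type u) [AddCommGroup X] [Module R X] (d : ℕ) :
    moduleDepth R (ModuleCat.of R X) = d ↔ DGE R (IsLocalRing.ResidueField R) d X ∧
      ¬ Subsingleton (EE R (IsLocalRing.ResidueField R) X d) := by
  have key : ∀ n, Nontrivial (ExtMod R (ModuleCat.of R (IsLocalRing.ResidueField R))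
      (ModuleCat.of R X) n) ↔ ¬ Subsingleton (EE R (IsLocalRing.ResidueField R) X n) := by
    intro n
    rw [← not_subsingleton_iff_nontrivial, bridge]
  unfold moduleDepth
  simp only [key]
  constructor
  · intro h
    have hmin : ∀ n : ℕ, ¬ Subsingleton (EE R (IsLocalRing.ResidueField R) X n) → d ≤ n := by
      intro n hn
      have : (d : ℕ∞) ≤ n := by
        rw [← h]
        exact sInf_le ⟨n, rfl, hn⟩
      exact_mod_cast this
    refine ⟨fun j hj => by_contra fun hn => absurd (hmin j hn) (by omega), ?_⟩
    have hne : {i : ℕ∞ | ∃ n : ℕ, i = n ∧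
        ¬ Subsingleton (EE R (IsLocalRing.ResidueField R) X n)}.Nonempty := by
      by_contra hne
      rw [Set.not_nonempty_iff_eq_empty] at hne
      rw [hne, sInf_empty] at h
      exact ENat.natCast_ne_top d h.symm
    obtain ⟨n, hn, hn2⟩ := csInf_mem hne
    rw [h] at hn
    have : d = n := by exact_mod_cast hn
    rw [this]; exact hn2
  · rintro ⟨h1, h2⟩
    apply le_antisymm
    · exact sInf_le ⟨d, rfl, h2⟩
    · refine le_sInf ?_
      rintro _ ⟨n, rfl, hn⟩
      by_contra hlt
      exact hn (h1 n (by exact_mod_cast not_le.1 hlt))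

end Final

theorem stmt14 (R : Type u) [CommRing R] [IsLocalRing R] [IsNoetherianRing R]
    [IsAdicComplete (IsLocalRing.maximalIdeal R) R] (d : ℕ)
    (hCM : IsCMLocalOfDim R d)
    (w : Type u) [AddCommGroup w] [Module R w] (hw : IsCanonicalModule R w)
    (M : Type u) [AddCommGroup M] [Module R M] [Module.Finite R M] (hM : Nontrivial M)
    (hG : FiniteGdim R (M →ₗ[R] R))
    (h1 : ∀ i : ℕ, 1 ≤ i → i ≤ d →
      Subsingleton (ExtMod R (ModuleCat.of R M) (ModuleCat.of R R) i)) :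
    TotallyReflexive R (M →ₗ[R] R) ∧ moduleDepth R (ModuleCat.of R M) = d := by
  obtain ⟨hd, hE⟩ := (moduleDepth_eq_iff R d).1 hCM.2
  obtain ⟨n, hn⟩ := hG
  obtain ⟨t, p, hp⟩ := Module.Finite.exists_fin' R M
  obtain ⟨s, φ, hφ⟩ := exists_cover p
  have hTr := depth_tr hd d le_rfl s t M φ p hp hφ
    (fun n hn => (bridge _ _ _ _).1 (h1 (n+1) (by omega) (by omega)))
  have e1 := exact_transpose hp hφ
  have inj1 : Function.Injective (Module.Dual.transpose (R := R) p) :=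
    LinearMap.dualMap_injective_of_surjective hp
  have S1 := SE.mkQ _ inj1
  have S2 := SE.of_exact _ _ _ e1
    (LinearMap.exact_map_mkQ_range (Module.Dual.transpose (R := R) φ))
    (Submodule.mkQ_surjective _)
  have F0 : TRf R (Module.Dual R (Fin t → R)) := trf_free _
  have F1 : TRf R (Module.Dual R (Fin s → R)) := trf_free _
  have dZ := S2.dge' (TRf.dge hd d le_rfl _ F1) hTr
  have dK := S1.dge' (TRf.dge hd d le_rfl _ F0) dZ
  have tK : TRf R (Module.Dual R M) := trf_of_gdim hd hE n _ hn dK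
  have tZ := S1.trf_of_depth hd hE tK F0 dZ
  have tT := S2.trf_of_depth hd hE tZ F1 hTr
  have bij : Function.Bijective (Module.Dual.eval R M) := by
    constructor
    · rw [injective_iff_map_eq_zero]
      intro m hm
      obtain ⟨v, rfl⟩ := hp m
      have hm' : ∀ f : Module.Dual R M, f (p v) = 0 := fun f => LinearMap.congr_fun hm f
      obtain ⟨g, hg⟩ := S2.extend (tT.extA 0)
        ((LinearMap.range (Module.Dual.transpose (R := R) p)).liftQ (Module.Dual.eval R _ v) (by
          rintro _ ⟨f, rfl⟩
          exact hm' f))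
      obtain ⟨x, rfl⟩ := (Module.bijective_dual_eval R (Fin s → R)).2 g
      have : v = φ x := by
        apply (Module.bijective_dual_eval R (Fin t → R)).1
        refine LinearMap.ext fun f => ?_
        exact (LinearMap.congr_fun hg (Submodule.Quotient.mk f)).symm
      rw [this]
      exact hφ.apply_apply_eq_zero x
    · intro ξ
      obtain ⟨ζ, hζ⟩ := S1.extend (tZ.extA 0) ξ
      obtain ⟨v, rfl⟩ := (Module.bijective_dual_eval R (Fin t → R)).2 ζ
      exact ⟨p v, hζ⟩
  have tM : TRf R M :=
    ⟨bij, fun n => ext_congr (LinearEquiv.ofBijective _ bij).symm (tK.extD n), tK.extA⟩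
  refine ⟨trf_iff.1 tK, (moduleDepth_eq_iff M d).2 ⟨TRf.dge hd d le_rfl M tM, fun hs => ?_⟩⟩
  have hne : (⊥ : Submodule R (Module.Dual R M)) ≠ ⊤ := by
    intro hbt
    obtain ⟨m, hm⟩ := exists_ne (0 : M)
    apply hm
    apply bij.1
    refine LinearMap.ext fun f => ?_
    have : f = 0 := by
      have : f ∈ (⊥ : Submodule R (Module.Dual R M)) := hbt ▸ Submodule.mem_top
      simpa using this
    simp [this]
  obtain ⟨χ, hχ, -⟩ := exists_hom hE _ _ hne
  obtain ⟨a, ha⟩ := tM.esurj hd χ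
  apply hχ
  refine LinearMap.ext fun f => ?_
  rw [← ha, show a = 0 from Subsingleton.elim _ _, push_zero_right]
  rfl
end
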